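/- arXiv:0910.0267 — 4 statements merged into one kernel-verified Lean document; each statement's English description precedes it below -/
import Mathlib

section
/- (Moon's theorem, amalgamated case.) Let G = A ∗_C B be an amalgamated free product, where C is a free abelian group of finite rank (C ≅ ℤⁿ for some n). Suppose that neither A nor B contains a finitely generated nontrivial normal subgroup of infinite index. If N is a finitely generated normal subgroup of G with N not contained in C, then either the quotient G/N is finite or N is a free group. -/
open Monoid

/-- The permutation representation of `G` on finitely supported integer-valued functions on `X`. -/
noncomputable def permRep (G X : Type*) [Group G] [MulAction G X] :
    Representation ℤ G (X →₀ ℤ) where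
  toFun g := Finsupp.lmapDomain ℤ ℤ (g • ·)
  map_one' := by
    ext x : 2
    simp
  map_mul' g h := by
    ext x : 2
    simp [mul_smul]

section PermRep

variable {G X : Type*} [Group G] [MulAction G X]

@[simp]
theorem permRep_single (g : G) (x : X) (r : ℤ) :
    permRep G X g (Finsupp.single x r) = Finsupp.single (g • x) r := by
  simp [permRep]

theorem permRep_apply (g : G) (v : X →₀ ℤ) (x : X) :
    permRep G X g v x = v (g⁻¹ • x) := by
  have h := Finsupp.mapDomain_apply (MulAction.injective g) v (g⁻¹ • x)
  rwa [smul_inv_smul] at h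

theorem permRep_mul_apply (g h : G) (v : X →₀ ℤ) :
    permRep G X (g * h) v = permRep G X g (permRep G X h v) := by
  rw [map_mul, Module.End.mul_apply]

/-- The basis vector of the permutation module at `x`. -/
noncomputable def permBasis (G : Type*) {X : Type*} [Group G] [MulAction G X] (x : X) :
    (permRep G X).asModule :=
  (permRep G X).asModuleEquiv.symm (Finsupp.single x 1)

theorem single_smul_permBasis (g : G) (n : ℤ) (x : X) :
    MonoidAlgebra.single g n • permBasis G x =
      (permRep G X).asModuleEquiv.symm (Finsupp.single (g • x) n) := by
  rw [permBasis, Representation.single_smul]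
  simp only [LinearEquiv.apply_symm_apply, permRep_single]
  change n • Finsupp.single (g • x) (1 : ℤ) = Finsupp.single (g • x) n
  simp

/-- The relations of a permutation module are generated by the stabilizers of a set of
orbit representatives. -/
theorem ker_linearCombination_permBasis_le {Ω : Type*} (x : Ω → X)
    (hx : ∀ y, ∃ ω, ∃ g : G, g • x ω = y)
    (hx' : ∀ ω ω' (g : G), g • x ω = x ω' → ω = ω')
    (S : Ω → Set G) (hS : ∀ ω, MulAction.stabilizer G (x ω) ≤ Subgroup.closure (S ω)) :
    LinearMap.ker (Finsupp.linearCombination (MonoidAlgebra ℤ G) fun ω => permBasis G (x ω)) ≤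
      Submodule.span (MonoidAlgebra ℤ G)
        {v | ∃ ω, ∃ s ∈ S ω, v = Finsupp.single ω (MonoidAlgebra.single s (1 : ℤ) - 1)} := by
  set U := Submodule.span (MonoidAlgebra ℤ G)
    {v | ∃ ω, ∃ s ∈ S ω, v = Finsupp.single ω (MonoidAlgebra.single s (1 : ℤ) - 1)} with hU
  have key : ∀ ω, ∀ u ∈ Subgroup.closure (S ω), ∀ h : G,
      Finsupp.single ω (MonoidAlgebra.single (h * u) (1 : ℤ)) -
        Finsupp.single ω (MonoidAlgebra.single h (1 : ℤ)) ∈ U := by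
    intro ω u hu
    induction hu using Subgroup.closure_induction with
    | mem s hs =>
      intro h
      have := U.smul_mem (MonoidAlgebra.single h (1 : ℤ))
        (Submodule.subset_span ⟨ω, s, hs, rfl⟩)
      rw [Finsupp.smul_single, smul_eq_mul, mul_sub, mul_one, MonoidAlgebra.single_mul_single,
        mul_one, Finsupp.single_sub] at this
      exact this
    | one => simp
    | mul a b _ _ ha hb =>
      intro h
      have := U.add_mem (hb (h * a)) (ha h)
      simpa [mul_assoc] using this
    | inv a _ ha =>
      intro h
      have := U.neg_mem (ha (h * a⁻¹))
      simpa [mul_assoc] using this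
  choose om gg hgg using hx
  let ψ : (X →₀ ℤ) →ₗ[ℤ] ((Ω →₀ MonoidAlgebra ℤ G) ⧸ U) :=
    Finsupp.linearCombination ℤ fun y =>
      U.mkQ (Finsupp.single (om y) (MonoidAlgebra.single (gg y) (1 : ℤ)))
  have main : ∀ f : Ω →₀ MonoidAlgebra ℤ G,
      ψ ((permRep G X).asModuleEquiv (Finsupp.linearCombination (MonoidAlgebra ℤ G)
        (fun ω => permBasis G (x ω)) f)) = U.mkQ f := by
    intro f
    induction f using Finsupp.induction_linear with
    | zero => simp
    | add f g hf hg => simp only [map_add, hf, hg]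
    | single ω r =>
      rw [Finsupp.linearCombination_single]
      induction r using MonoidAlgebra.induction_linear with
      | zero => simp
      | add a b ha hb => simp only [add_smul, map_add, Finsupp.single_add, ha, hb]
      | single g n =>
        rw [single_smul_permBasis, LinearEquiv.apply_symm_apply, Finsupp.linearCombination_single]
        have h1 := hgg (g • x ω)
        have h2 : om (g • x ω) = ω := by
          apply hx' _ _ (g⁻¹ * gg (g • x ω))
          rw [mul_smul, h1, inv_smul_smul]
        rw [h2] at h1 ⊢
        have h3 : g⁻¹ * gg (g • x ω) ∈ MulAction.stabilizer G (x ω) := by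
          rw [MulAction.mem_stabilizer_iff, mul_smul, h1, inv_smul_smul]
        have h4 := key ω _ (hS ω h3) g
        rw [mul_inv_cancel_left] at h4
        have h5 : U.mkQ (Finsupp.single ω (MonoidAlgebra.single (gg (g • x ω)) (1 : ℤ))) =
            U.mkQ (Finsupp.single ω (MonoidAlgebra.single g (1 : ℤ))) := by
          rwa [← sub_eq_zero, ← map_sub, Submodule.mkQ_apply, Submodule.Quotient.mk_eq_zero]
        rw [h5, ← map_zsmul]
        congr 1
        simp
  intro f hf
  have := main f
  rw [LinearMap.mem_ker.1 hf, map_zero, map_zero] at this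
  rw [Submodule.mkQ_apply] at this
  exact (Submodule.Quotient.mk_eq_zero U).1 this.symm

theorem linearCombination_permBasis_surjective {Ω : Type*} (x : Ω → X)
    (hx : ∀ y, ∃ ω, ∃ g : G, g • x ω = y) :
    Function.Surjective
      (Finsupp.linearCombination (MonoidAlgebra ℤ G) fun ω => permBasis G (x ω)) := by
  intro v
  obtain ⟨w, rfl⟩ := (permRep G X).asModuleEquiv.symm.surjective v
  rw [← Set.mem_range, ← LinearMap.coe_range, SetLike.mem_coe]
  induction w using Finsupp.induction_linear with
  | zero => simp
  | add f g hf hg => rw [map_add]; exact add_mem hf hg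
  | single y n =>
    obtain ⟨ω, g, rfl⟩ := hx y
    exact ⟨Finsupp.single ω (MonoidAlgebra.single g n), by
      rw [Finsupp.linearCombination_single, single_smul_permBasis]⟩

/-- A permutation module with finitely many orbits and finitely generated stabilizers is
finitely presented. -/
theorem permRep_finitePresentation [Finite (MulAction.orbitRel.Quotient G X)]
    (h : ∀ x : X, (MulAction.stabilizer G x).FG) :
    Module.FinitePresentation (MonoidAlgebra ℤ G) (permRep G X).asModule := by
  classical
  let x : MulAction.orbitRel.Quotient G X → X := Quotient.out
  have hx : ∀ y, ∃ ω, ∃ g : G, g • x ω = y := fun y => by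
    have : (MulAction.orbitRel G X) y (x (Quotient.mk _ y)) :=
      Quotient.exact (Quotient.out_eq _).symm
    exact ⟨_, MulAction.mem_orbit_iff.1 (MulAction.orbitRel_apply.1 this)⟩
  have hx' : ∀ ω ω' (g : G), g • x ω = x ω' → ω = ω' := fun ω ω' g hg => by
    rw [← Quotient.out_eq ω, ← Quotient.out_eq ω']
    refine (Quotient.sound (MulAction.orbitRel_apply.2 ?_)).symm
    exact ⟨g, hg⟩
  choose S hS using fun ω => h (x ω)
  have hsurj := linearCombination_permBasis_surjective (G := G) x hx
  refine Module.finitePresentation_of_surjective _ hsurj ?_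
  have hker := ker_linearCombination_permBasis_le x hx hx' (fun ω => (S ω : Set G))
    (fun ω => (hS ω).ge)
  have heq : LinearMap.ker (Finsupp.linearCombination (MonoidAlgebra ℤ G)
      fun ω => permBasis G (x ω)) = Submodule.span (MonoidAlgebra ℤ G)
        {v | ∃ ω, ∃ s ∈ S ω, v = Finsupp.single ω (MonoidAlgebra.single s (1 : ℤ) - 1)} := by
    refine le_antisymm hker (Submodule.span_le.2 ?_)
    rintro _ ⟨ω, s, hs, rfl⟩
    have hs' : s • x ω = x ω := by
      rw [← MulAction.mem_stabilizer_iff, ← hS ω]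
      exact Subgroup.subset_closure hs
    rw [SetLike.mem_coe, LinearMap.mem_ker, Finsupp.linearCombination_single, sub_smul,
      single_smul_permBasis, hs', one_smul, permBasis, sub_self]
  rw [heq]
  refine Submodule.fg_span ?_
  have : {v | ∃ ω, ∃ s ∈ S ω, v = Finsupp.single ω (MonoidAlgebra.single s (1 : ℤ) - 1)} =
      ⋃ ω, (fun s => Finsupp.single ω (MonoidAlgebra.single s (1 : ℤ) - 1)) '' (S ω : Set G) := by
    ext v
    simp [eq_comm]
  rw [this]
  exact Set.finite_iUnion fun ω => (S ω).finite_toSet.image _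

/-- An equivariant linear map between permutation modules, as a map of group ring modules. -/
noncomputable def permLinearMap {Y : Type*} [MulAction G Y] (f : (X →₀ ℤ) →ₗ[ℤ] (Y →₀ ℤ))
    (hf : ∀ g v, f (permRep G X g v) = permRep G Y g (f v)) :
    (permRep G X).asModule →ₗ[MonoidAlgebra ℤ G] (permRep G Y).asModule :=
  Representation.IntertwiningMap.equivLinearMapAsModule _ _
    ⟨f, fun g => LinearMap.ext (hf g)⟩

theorem permLinearMap_apply {Y : Type*} [MulAction G Y] (f : (X →₀ ℤ) →ₗ[ℤ] (Y →₀ ℤ))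
    (hf : ∀ g v, f (permRep G X g v) = permRep G Y g (f v)) (v : X →₀ ℤ) :
    permLinearMap f hf ((permRep G X).asModuleEquiv.symm v) =
      (permRep G Y).asModuleEquiv.symm (f v) := rfl

/-- If a transitive permutation module is finitely presented then the stabilizers are finitely
generated. -/
theorem stabilizer_fg_of_isPretransitive [MulAction.IsPretransitive G X]
    [Module.FinitePresentation (MonoidAlgebra ℤ G) (permRep G X).asModule] (x : X) :
    (MulAction.stabilizer G x).FG := by
  classical
  have hx : ∀ y, ∃ _ : Unit, ∃ g : G, g • x = y := fun y => ⟨(), MulAction.exists_smul_eq G x y⟩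
  have hsurj := linearCombination_permBasis_surjective (G := G) (fun _ : Unit => x) hx
  have hfg := Module.FinitePresentation.fg_ker _ hsurj
  have hle := ker_linearCombination_permBasis_le (fun _ : Unit => x) hx (fun _ _ _ _ => rfl)
    (fun _ => (MulAction.stabilizer G x : Set G)) (fun _ => Subgroup.subset_closure)
  have heq := hle.antisymm (Submodule.span_le.2 (by
    rintro _ ⟨ω, s, hs, rfl⟩
    rw [SetLike.mem_coe, LinearMap.mem_ker, Finsupp.linearCombination_single, sub_smul,
      single_smul_permBasis, MulAction.mem_stabilizer_iff.1 hs, one_smul, permBasis, sub_self]))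
  rw [heq, Submodule.fg_span_iff_fg_span_finset_subset] at hfg
  obtain ⟨T, hT, hTspan⟩ := hfg
  have hT' : ∀ t ∈ T, ∃ s ∈ MulAction.stabilizer G x,
      t = Finsupp.single () (MonoidAlgebra.single s (1 : ℤ) - 1) := fun t ht =>
    let ⟨_, s, hs, h⟩ := hT ht
    ⟨s, hs, h⟩
  choose! s hs hs' using hT'
  let K : Subgroup G := Subgroup.closure (T.image s : Finset G)
  have hK : K ≤ MulAction.stabilizer G x := by
    rw [Subgroup.closure_le]
    intro g hg
    obtain ⟨t, ht, rfl⟩ := Finset.mem_image.1 (Finset.mem_coe.1 hg)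
    exact hs t ht
  suffices h : MulAction.stabilizer G x ≤ K by
    rw [h.antisymm hK]
    exact ⟨_, rfl⟩
  intro u hu
  let y : G ⧸ K := ((1 : G) : G ⧸ K)
  have hmem : (Finsupp.single () (MonoidAlgebra.single u (1 : ℤ) - 1) :
      Unit →₀ MonoidAlgebra ℤ G) ∈ LinearMap.ker
        (Finsupp.linearCombination (MonoidAlgebra ℤ G) fun _ : Unit => permBasis G y) := by
    have h1 : (Finsupp.single () (MonoidAlgebra.single u (1 : ℤ) - 1) :
      Unit →₀ MonoidAlgebra ℤ G) ∈ Submodule.span (MonoidAlgebra ℤ G) (T : Set (Unit →₀ _)) := by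
      rw [← hTspan]
      exact Submodule.subset_span ⟨(), u, hu, rfl⟩
    refine (Submodule.span_le.2 ?_) h1
    intro t ht
    have h2 : s t • y = y := by
      change ((s t * 1 : G) : G ⧸ K) = _
      rw [mul_one, eq_comm, QuotientGroup.eq, inv_one, one_mul]
      exact Subgroup.subset_closure (Finset.mem_coe.2 (Finset.mem_image_of_mem s ht))
    rw [hs' t ht, SetLike.mem_coe, LinearMap.mem_ker, Finsupp.linearCombination_single, sub_smul,
      single_smul_permBasis, h2, one_smul, permBasis, sub_self]
  rw [LinearMap.mem_ker, Finsupp.linearCombination_single, sub_smul, single_smul_permBasis,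
    one_smul, permBasis, sub_eq_zero] at hmem
  have h3 := Finsupp.single_left_injective one_ne_zero
    ((permRep G (G ⧸ K)).asModuleEquiv.symm.injective hmem)
  have h4 : ((1 : G) : G ⧸ K) = ((u * 1 : G) : G ⧸ K) := h3.symm
  rw [QuotientGroup.eq] at h4
  simpa using h4

/-- If a permutation module is finitely presented then the stabilizers are finitely generated. -/
theorem stabilizer_fg_of_finitePresentation
    [Module.FinitePresentation (MonoidAlgebra ℤ G) (permRep G X).asModule] (x : X) :
    (MulAction.stabilizer G x).FG := by
  classical
  let O := MulAction.orbit G x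
  let inc : (O →₀ ℤ) →ₗ[ℤ] (X →₀ ℤ) := Finsupp.lmapDomain ℤ ℤ Subtype.val
  have hinc : ∀ g v, inc (permRep G O g v) = permRep G X g (inc v) := fun g v => by
    induction v using Finsupp.induction_linear with
    | zero => simp
    | add a b ha hb => simp only [map_add, ha, hb]
    | single y n => simp [inc, Finsupp.mapDomain_single]; rfl
  let ret : (X →₀ ℤ) →ₗ[ℤ] (O →₀ ℤ) := Finsupp.lcomapDomain Subtype.val Subtype.val_injective
  have hret_apply : ∀ v (y : O), ret v y = v y := fun v y => rfl
  have hret : ∀ g v, ret (permRep G X g v) = permRep G O g (ret v) := fun g v => by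
    ext y
    rw [hret_apply, permRep_apply, permRep_apply, hret_apply]
    rfl
  have hri : ∀ v, ret (inc v) = v := fun v => by
    ext y
    rw [hret_apply]
    exact Finsupp.mapDomain_apply Subtype.val_injective v y
  let I := permLinearMap inc hinc
  let R := permLinearMap ret hret
  have hRI : ∀ v, R (I v) = v := hri
  have hRsurj : Function.Surjective R := fun v => ⟨I v, hRI v⟩
  have hker : LinearMap.ker R = LinearMap.range (LinearMap.id - I ∘ₗ R) := by
    ext v
    constructor
    · intro hv
      exact ⟨v, by simp [LinearMap.mem_ker.1 hv]⟩
    · rintro ⟨w, rfl⟩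
      simp [hRI]
  have : Module.FinitePresentation (MonoidAlgebra ℤ G) (permRep G O).asModule := by
    refine Module.finitePresentation_of_surjective R hRsurj ?_
    rw [hker]
    exact Module.Finite.iff_fg.1 inferInstance
  have h := stabilizer_fg_of_isPretransitive (G := G) (⟨x, MulAction.mem_orbit_self x⟩ : O)
  convert h using 1
  ext g
  rw [MulAction.mem_stabilizer_iff, MulAction.mem_stabilizer_iff, Subtype.ext_iff]
  rfl

end PermRep

section Amalgam

variable {H : Type*} [Group H] {K : Bool → Type*} [∀ i, Group (K i)] (φ : ∀ i, H →* K i)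

/-- The edges of the Bass-Serre tree of an amalgamated product. -/
abbrev TreeEdge := PushoutI φ ⧸ (PushoutI.base φ).range

/-- The vertices of the Bass-Serre tree of an amalgamated product. -/
abbrev TreeVertex := Σ i : Bool, PushoutI φ ⧸ (PushoutI.of (φ := φ) i).range

/-- The edge of the Bass-Serre tree with stabilizer the amalgamated subgroup. -/
def baseEdge : TreeEdge φ := ((1 : PushoutI φ) : TreeEdge φ)

/-- The chain joining the base vertex stabilized by `K false` to the one stabilized by `K i`. -/
noncomputable def basePath (i : Bool) : TreeEdge φ →₀ ℤ :=
  if i then Finsupp.single (baseEdge φ) 1 else 0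

/-- A permutation representation as an action by permutations. -/
noncomputable def permRepPerm (G X : Type*) [Group G] [MulAction G X] :
    G →* Equiv.Perm (X →₀ ℤ) where
  toFun g := ⟨permRep G X g, permRep G X g⁻¹, fun v => by
    rw [← permRep_mul_apply, inv_mul_cancel, map_one, Module.End.one_apply], fun v => by
    rw [← permRep_mul_apply, mul_inv_cancel, map_one, Module.End.one_apply]⟩
  map_one' := by ext1 v; change permRep G X 1 v = v; rw [map_one, Module.End.one_apply]
  map_mul' g h := by ext1 v; exact permRep_mul_apply g h v

variable {φ}

theorem base_smul_baseEdge (h : H) : PushoutI.base φ h • baseEdge φ = baseEdge φ := by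
  change ((PushoutI.base φ h * 1 : PushoutI φ) : TreeEdge φ) = _
  rw [mul_one, baseEdge, eq_comm, QuotientGroup.eq, inv_one, one_mul]
  exact ⟨h, rfl⟩

theorem permRep_base_basePath (h : H) (i : Bool) :
    permRep (PushoutI φ) _ (PushoutI.base φ h) (basePath φ i) = basePath φ i := by
  cases i <;> simp [basePath, base_smul_baseEdge]

theorem permRepPerm_apply {G X : Type*} [Group G] [MulAction G X] (g : G) (v : X →₀ ℤ) :
    permRepPerm G X g v = permRep G X g v := rfl

variable (φ) in
/-- The affine action of `K i` on the edge chains which fixes `basePath φ i`. -/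
noncomputable def factorAction (i : Bool) : K i →* Equiv.Perm (TreeEdge φ →₀ ℤ) :=
  (MulAut.conj (Equiv.addRight (basePath φ i))).toMonoidHom.comp
    ((permRepPerm (PushoutI φ) (TreeEdge φ)).comp (PushoutI.of i))

theorem factorAction_apply (i : Bool) (x : K i) (v : TreeEdge φ →₀ ℤ) :
    factorAction φ i x v =
      permRep (PushoutI φ) (TreeEdge φ) (PushoutI.of i x) (v - basePath φ i) + basePath φ i := by
  rw [sub_eq_add_neg]
  rfl

variable (φ) in
/-- The affine action of an amalgamated product on the edge chains of its Bass-Serre tree, in which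
`K i` fixes `basePath φ i`. -/
noncomputable def affineAction : PushoutI φ →* Equiv.Perm (TreeEdge φ →₀ ℤ) :=
  PushoutI.lift (factorAction φ) ((permRepPerm (PushoutI φ) (TreeEdge φ)).comp (PushoutI.base φ))
    (fun i => by
      ext1 h
      ext1 v
      rw [MonoidHom.comp_apply, MonoidHom.comp_apply, factorAction_apply, permRepPerm_apply,
        PushoutI.of_apply_eq_base, map_sub, permRep_base_basePath, sub_add_cancel])

/-- The chain in the Bass-Serre tree from the base vertex stabilized by `K false` to its translate
by `g`. -/
noncomputable def pathChain (g : PushoutI φ) : TreeEdge φ →₀ ℤ := affineAction φ g 0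

theorem affineAction_of (i : Bool) (x : K i) (v : TreeEdge φ →₀ ℤ) :
    affineAction φ (PushoutI.of i x) v =
      permRep (PushoutI φ) _ (PushoutI.of i x) (v - basePath φ i) + basePath φ i := by
  rw [affineAction, PushoutI.lift_of, factorAction_apply]

theorem affineAction_base (h : H) (v : TreeEdge φ →₀ ℤ) :
    affineAction φ (PushoutI.base φ h) v = permRep (PushoutI φ) _ (PushoutI.base φ h) v := by
  rw [affineAction, PushoutI.lift_base]
  rfl

theorem affineAction_apply (g : PushoutI φ) (v : TreeEdge φ →₀ ℤ) :
    affineAction φ g v = permRep (PushoutI φ) _ g v + pathChain g := by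
  induction g using PushoutI.induction_on generalizing v with
  | of i x => rw [pathChain, affineAction_of, affineAction_of]; simp only [map_sub, map_zero]; abel
  | base h => rw [pathChain, affineAction_base, affineAction_base, map_zero, add_zero]
  | mul x y hx hy =>
    rw [pathChain, map_mul, Equiv.Perm.mul_apply, Equiv.Perm.mul_apply, hy, hx, hx,
      permRep_mul_apply, ← pathChain, map_add]
    abel

theorem pathChain_mul (g h : PushoutI φ) :
    pathChain (g * h) = permRep (PushoutI φ) _ g (pathChain h) + pathChain g := by
  rw [pathChain, map_mul, Equiv.Perm.mul_apply, affineAction_apply, ← pathChain]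

theorem pathChain_one : pathChain (1 : PushoutI φ) = 0 := by
  rw [pathChain, map_one, Equiv.Perm.one_apply]

theorem pathChain_of (i : Bool) (x : K i) :
    pathChain (PushoutI.of i x : PushoutI φ) =
      basePath φ i - permRep (PushoutI φ) _ (PushoutI.of i x) (basePath φ i) := by
  rw [pathChain, affineAction_of, zero_sub, map_neg]
  abel

theorem permRep_pathChain_inv (g : PushoutI φ) :
    permRep (PushoutI φ) _ g (pathChain g⁻¹) = -pathChain g := by
  rw [← add_eq_zero_iff_eq_neg, ← pathChain_mul, mul_inv_cancel, pathChain_one]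

theorem Monoid.PushoutI.induction_of {motive : PushoutI φ → Prop} (x : PushoutI φ)
    (of : ∀ (i : Bool) (g : K i), motive (PushoutI.of i g))
    (mul : ∀ x y, motive x → motive y → motive (x * y)) : motive x :=
  PushoutI.induction_on x of
    (fun h => by rw [← PushoutI.of_apply_eq_base φ true h]; exact of true (φ true h)) mul

/-- The chain from the base vertex stabilized by `K false` to a given vertex. -/
noncomputable def vertexChain (v : TreeVertex φ) : TreeEdge φ →₀ ℤ :=
  Quotient.liftOn' v.2 (fun g => pathChain g + permRep (PushoutI φ) _ g (basePath φ v.1)) (by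
    intro a b hab
    obtain ⟨x, hx⟩ := QuotientGroup.leftRel_apply.1 hab
    obtain rfl : b = a * PushoutI.of v.1 x := by rw [hx, mul_inv_cancel_left]
    rw [pathChain_mul, pathChain_of, permRep_mul_apply, map_sub]
    abel)

theorem vertexChain_mk (i : Bool) (g : PushoutI φ) :
    vertexChain (⟨i, (g : PushoutI φ ⧸ _)⟩ : TreeVertex φ) =
      pathChain g + permRep (PushoutI φ) _ g (basePath φ i) := rfl

/-- The endpoints of an edge. -/
def edgeVertex (i : Bool) (e : TreeEdge φ) : TreeVertex φ :=
  ⟨i, Quotient.liftOn' e (fun g => (g : PushoutI φ ⧸ _)) (by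
    intro a b hab
    obtain ⟨x, hx⟩ := QuotientGroup.leftRel_apply.1 hab
    refine QuotientGroup.eq.2 ⟨φ i x, ?_⟩
    rw [PushoutI.of_apply_eq_base, hx])⟩

theorem edgeVertex_smul (i : Bool) (g : PushoutI φ) (e : TreeEdge φ) :
    edgeVertex i (g • e) = g • edgeVertex i e := by
  induction e using QuotientGroup.induction_on with
  | H a => rfl

variable (φ) in
/-- The boundary map of the Bass-Serre tree. -/
noncomputable def boundary : (TreeEdge φ →₀ ℤ) →ₗ[ℤ] (TreeVertex φ →₀ ℤ) :=
  Finsupp.lmapDomain ℤ ℤ (edgeVertex true) - Finsupp.lmapDomain ℤ ℤ (edgeVertex false)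

theorem boundary_single (e : TreeEdge φ) (n : ℤ) :
    boundary φ (Finsupp.single e n) =
      Finsupp.single (edgeVertex true e) n - Finsupp.single (edgeVertex false e) n := by
  simp [boundary]

theorem boundary_permRep (g : PushoutI φ) (v : TreeEdge φ →₀ ℤ) :
    boundary φ (permRep (PushoutI φ) _ g v) = permRep (PushoutI φ) _ g (boundary φ v) := by
  induction v using Finsupp.induction_linear with
  | zero => simp
  | add a b ha hb => simp only [map_add, ha, hb]
  | single y n => simp [boundary_single, edgeVertex_smul]

variable (φ) in
/-- The contraction of the Bass-Serre tree onto the base vertex stabilized by `K false`. -/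
noncomputable def contraction : (TreeVertex φ →₀ ℤ) →ₗ[ℤ] (TreeEdge φ →₀ ℤ) :=
  Finsupp.linearCombination ℤ vertexChain

theorem contraction_single (v : TreeVertex φ) (n : ℤ) :
    contraction φ (Finsupp.single v n) = n • vertexChain v := by
  simp [contraction]

theorem contraction_boundary (v : TreeEdge φ →₀ ℤ) : contraction φ (boundary φ v) = v := by
  induction v using Finsupp.induction_linear with
  | zero => simp
  | add a b ha hb => simp only [map_add, ha, hb]
  | single y n =>
    induction y using QuotientGroup.induction_on with
    | H g =>
      rw [boundary_single, map_sub, contraction_single, contraction_single, ← smul_sub]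
      change n • (vertexChain ⟨true, (g : PushoutI φ ⧸ _)⟩ -
        vertexChain ⟨false, (g : PushoutI φ ⧸ _)⟩) = _
      rw [vertexChain_mk, vertexChain_mk, add_sub_add_left_eq_sub, ← map_sub]
      have : g • baseEdge φ = (g : TreeEdge φ) :=
        congrArg (fun a : PushoutI φ => (a : TreeEdge φ)) (mul_one g)
      simp [basePath, this]

/-- The base vertices. -/
def baseVertex (φ : ∀ i, H →* K i) (i : Bool) : TreeVertex φ :=
  ⟨i, QuotientGroup.mk 1⟩

theorem of_smul_baseVertex (i : Bool) (x : K i) :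
    (PushoutI.of i x : PushoutI φ) • baseVertex φ i = baseVertex φ i := by
  refine Sigma.ext rfl (heq_of_eq ?_)
  change (QuotientGroup.mk (PushoutI.of i x * 1) :
    PushoutI φ ⧸ (PushoutI.of (φ := φ) i).range) = QuotientGroup.mk 1
  rw [mul_one, eq_comm, QuotientGroup.eq, inv_one, one_mul]
  exact ⟨x, rfl⟩

theorem boundary_basePath (i : Bool) :
    boundary φ (basePath φ i) =
      Finsupp.single (baseVertex φ i) 1 - Finsupp.single (baseVertex φ false) 1 := by
  cases i
  · simp [basePath]
  · simp only [basePath, if_true, boundary_single]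
    rfl

theorem boundary_pathChain (g : PushoutI φ) :
    boundary φ (pathChain g) =
      Finsupp.single (g • baseVertex φ false) 1 - Finsupp.single (baseVertex φ false) 1 := by
  induction g using PushoutI.induction_of with
  | of i x =>
    rw [pathChain_of, map_sub, boundary_permRep, boundary_basePath, map_sub, permRep_single,
      permRep_single, of_smul_baseVertex]
    abel
  | mul x y hx hy =>
    rw [pathChain_mul, map_add, boundary_permRep, hx, hy, map_sub, permRep_single, permRep_single,
      mul_smul]
    abel

theorem boundary_vertexChain (v : TreeVertex φ) :
    boundary φ (vertexChain v) = Finsupp.single v 1 - Finsupp.single (baseVertex φ false) 1 := by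
  obtain ⟨i, a⟩ := v
  induction a using QuotientGroup.induction_on with
  | H g =>
    rw [vertexChain_mk, map_add, boundary_permRep, boundary_basePath, boundary_pathChain, map_sub,
      permRep_single, permRep_single]
    have : g • baseVertex φ i = ⟨i, (g : PushoutI φ ⧸ _)⟩ :=
      Sigma.ext rfl (heq_of_eq (congrArg
        (QuotientGroup.mk : PushoutI φ → PushoutI φ ⧸ (PushoutI.of (φ := φ) i).range) (mul_one g)))
    rw [this]
    abel

variable (φ) in
/-- The augmentation of the chain complex of the Bass-Serre tree. -/
noncomputable def augmentation : (TreeVertex φ →₀ ℤ) →ₗ[ℤ] (Unit →₀ ℤ) :=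
  Finsupp.lmapDomain ℤ ℤ fun _ => ()

theorem augmentation_single (v : TreeVertex φ) (n : ℤ) :
    augmentation φ (Finsupp.single v n) = Finsupp.single () n := by
  simp [augmentation]

theorem augmentation_boundary (v : TreeEdge φ →₀ ℤ) : augmentation φ (boundary φ v) = 0 := by
  induction v using Finsupp.induction_linear with
  | zero => simp
  | add a b ha hb => simp only [map_add, ha, hb, add_zero]
  | single y n => simp [boundary_single, augmentation_single]

theorem boundary_contraction (v : TreeVertex φ →₀ ℤ) :
    boundary φ (contraction φ v) =
      v - Finsupp.single (baseVertex φ false) (augmentation φ v ()) := by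
  induction v using Finsupp.induction_linear with
  | zero => simp
  | add a b ha hb => simp only [map_add, ha, hb, Finsupp.add_apply, Finsupp.single_add]; abel
  | single y n =>
    rw [contraction_single, map_zsmul, boundary_vertexChain, augmentation_single, smul_sub]
    simp

end Amalgam

section VertexStabilizers

variable {H : Type*} [Group H] {K : Bool → Type*} [∀ i, Group (K i)] {φ : ∀ i, H →* K i}

/-- The vertex module of the Bass-Serre tree is finitely presented over a finitely generated
subgroup acting with finitely many edge orbits and finitely generated edge stabilizers. -/
theorem finitePresentation_treeVertex (N : Subgroup (PushoutI φ)) (hN : N.FG)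
    [Finite (MulAction.orbitRel.Quotient N (TreeEdge φ))]
    (h : ∀ e : TreeEdge φ, (MulAction.stabilizer N e).FG) :
    Module.FinitePresentation (MonoidAlgebra ℤ N) (permRep N (TreeVertex φ)).asModule := by
  have hE : Module.FinitePresentation (MonoidAlgebra ℤ N) (permRep N (TreeEdge φ)).asModule :=
    permRep_finitePresentation h
  have hU : Module.FinitePresentation (MonoidAlgebra ℤ N) (permRep N Unit).asModule := by
    refine permRep_finitePresentation fun x => ?_
    have : MulAction.stabilizer N x = ⊤ := by
      ext
      simp only [Subgroup.mem_top, iff_true]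
      rfl
    rw [this, ← Group.fg_def, Group.fg_iff_subgroup_fg]
    exact hN
  let ε := permLinearMap (G := N) (augmentation φ) (fun g v => by
    induction v using Finsupp.induction_linear with
    | zero => simp
    | add a b ha hb => simp only [map_add, ha, hb]
    | single y n => simp [augmentation_single])
  let δ := permLinearMap (G := N) (boundary φ) (fun g v => boundary_permRep (g : PushoutI φ) v)
  have hε : Function.Surjective ε := fun v => by
    obtain ⟨v, rfl⟩ := (permRep N Unit).asModuleEquiv.symm.surjective v
    refine ⟨(permRep N (TreeVertex φ)).asModuleEquiv.symm
      (Finsupp.single (baseVertex φ false) (v ())), ?_⟩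
    rw [permLinearMap_apply, augmentation_single]
    congr 1
    ext
    simp
  have hδ : Function.Injective δ := fun v w hvw => by
    have := congrArg (fun x => contraction φ x) hvw
    exact (contraction_boundary v).symm.trans (this.trans (contraction_boundary w))
  have hker : LinearMap.range δ = LinearMap.ker ε := by
    ext v
    constructor
    · rintro ⟨w, rfl⟩
      exact augmentation_boundary w
    · intro hv
      have hv' : augmentation φ v = 0 := hv
      refine ⟨(permRep N (TreeEdge φ)).asModuleEquiv.symm (contraction φ v), ?_⟩
      refine (boundary_contraction v).trans ?_
      rw [hv', Finsupp.zero_apply, Finsupp.single_zero]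
      exact sub_zero (G := TreeVertex φ →₀ ℤ) v
  have : Module.FinitePresentation (MonoidAlgebra ℤ N) (LinearMap.ker ε) := by
    rw [← hker]
    exact Module.FinitePresentation.of_equiv (LinearEquiv.ofInjective δ hδ)
  exact Module.finitePresentation_of_ker ε hε

/-- Under the finiteness conditions above, the vertex stabilizers are finitely generated. -/
theorem comap_of_fg (hφ : ∀ i, Function.Injective (φ i)) (N : Subgroup (PushoutI φ)) (hN : N.FG)
    [Finite (MulAction.orbitRel.Quotient N (TreeEdge φ))]
    (h : ∀ e : TreeEdge φ, (MulAction.stabilizer N e).FG) (i : Bool) :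
    (N.comap (PushoutI.of (φ := φ) i)).FG := by
  have := finitePresentation_treeVertex N hN h
  have hst : (MulAction.stabilizer N (baseVertex φ i)).FG := stabilizer_fg_of_finitePresentation _
  have hmap : (N.comap (PushoutI.of (φ := φ) i)).map (PushoutI.of i) =
      (MulAction.stabilizer N (baseVertex φ i)).map N.subtype := by
    ext g
    simp only [Subgroup.mem_map, Subgroup.mem_comap, MulAction.mem_stabilizer_iff]
    constructor
    · rintro ⟨x, hx, rfl⟩
      exact ⟨⟨_, hx⟩, of_smul_baseVertex i x, rfl⟩
    · rintro ⟨n, hn, rfl⟩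
      have h1 := eq_of_heq (Sigma.ext_iff.1 hn).2
      have h2 : ((n : PushoutI φ) : PushoutI φ ⧸ (PushoutI.of (φ := φ) i).range) =
          ((1 : PushoutI φ) : PushoutI φ ⧸ (PushoutI.of (φ := φ) i).range) :=
        (congrArg (fun a : PushoutI φ => (a : PushoutI φ ⧸ (PushoutI.of (φ := φ) i).range))
          (mul_one (n : PushoutI φ))).symm.trans h1
      rw [eq_comm, QuotientGroup.eq, inv_one, one_mul] at h2
      obtain ⟨x, hx⟩ := h2
      exact ⟨x, hx ▸ n.2, hx⟩
  rw [Subgroup.fg_iff_submonoid_fg] at hst ⊢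
  have h3 := hst.map N.subtype
  change ((MulAction.stabilizer N (baseVertex φ i)).map N.subtype).toSubmonoid.FG at h3
  rw [← hmap] at h3
  exact Submonoid.FG.map_injective (PushoutI.of (φ := φ) i) (PushoutI.of_injective hφ i) h3

end VertexStabilizers

/-- A group embedding in a free abelian group of finite rank is finitely generated. -/
theorem Group.fg_of_injective_pi_int {G : Type*} [Group G] {n : ℕ}
    (f : G →* Multiplicative (Fin n → ℤ)) (hf : Function.Injective f) : Group.FG G := by
  have h : f.range.FG := by
    rw [Subgroup.fg_iff_add_fg]
    have := IsNoetherian.noetherian (R := ℤ) (AddSubgroup.toIntSubmodule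
      (Subgroup.toAddSubgroup f.range : AddSubgroup (Fin n → ℤ)))
    rwa [Submodule.fg_iff_addSubgroup_fg] at this
  have := (Group.fg_iff_subgroup_fg _).2 h
  exact Group.fg_of_surjective (f := (MonoidHom.ofInjective hf).symm.toMonoidHom)
    (MulEquiv.surjective _)

section Edges

variable {H : Type*} [Group H] {K : Bool → Type*} [∀ i, Group (K i)] {φ : ∀ i, H →* K i}

theorem Monoid.PushoutI.base_injective_of_injective (hφ : ∀ i, Function.Injective (φ i)) :
    Function.Injective (PushoutI.base φ) := by
  have h := (PushoutI.of_injective hφ true).comp (hφ true)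
  intro a b hab
  apply h
  simpa [PushoutI.of_apply_eq_base] using hab

/-- Edge stabilizers are finitely generated when the amalgamated subgroup is free abelian of
finite rank. -/
theorem stabilizer_treeEdge_fg (hφ : ∀ i, Function.Injective (φ i)) {n : ℕ}
    (f : H ≃* Multiplicative (Fin n → ℤ)) (N : Subgroup (PushoutI φ)) (e : TreeEdge φ) :
    (MulAction.stabilizer N e).FG := by
  induction e using QuotientGroup.induction_on with
  | H g =>
    rw [← Group.fg_iff_subgroup_fg]
    have hmem : ∀ s : MulAction.stabilizer N (g : TreeEdge φ),
        g⁻¹ * ((s : N) : PushoutI φ) * g ∈ (PushoutI.base φ).range := fun s => by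
      have h1 : (((s : N) : PushoutI φ) * g : PushoutI φ) = (g : TreeEdge φ) := s.2
      rw [eq_comm, QuotientGroup.eq, ← mul_assoc] at h1
      exact h1
    let e := MonoidHom.ofInjective (PushoutI.base_injective_of_injective hφ)
    let c : MulAction.stabilizer N (g : TreeEdge φ) →* (PushoutI.base φ).range :=
      ((MulAut.conj g⁻¹).toMonoidHom.comp
        (N.subtype.comp (MulAction.stabilizer N (g : TreeEdge φ)).subtype)).codRestrict _
        (fun s => by simpa using hmem s)
    refine Group.fg_of_injective_pi_int (f.toMonoidHom.comp (e.symm.toMonoidHom.comp c)) ?_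
    refine f.injective.comp (e.symm.injective.comp ?_)
    intro s t hst
    have := congrArg Subtype.val hst
    exact Subtype.ext (Subtype.ext ((MulAut.conj g⁻¹).injective this))

/-- A normal subgroup has finitely many edge orbits when its product with the amalgamated subgroup
has finite index. -/
theorem finite_orbitRel_treeEdge (N : Subgroup (PushoutI φ)) [N.Normal]
    (h : (N ⊔ (PushoutI.base φ).range).FiniteIndex) :
    Finite (MulAction.orbitRel.Quotient N (TreeEdge φ)) := by
  have : Finite (PushoutI φ ⧸ (N ⊔ (PushoutI.base φ).range)) := inferInstance
  refine Finite.of_surjective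
    (Quotient.lift (fun g : PushoutI φ => (Quotient.mk _ (g : TreeEdge φ) :
      MulAction.orbitRel.Quotient N (TreeEdge φ))) ?_ :
      PushoutI φ ⧸ (N ⊔ (PushoutI.base φ).range) → _) ?_
  · intro a b hab
    have h1 : a⁻¹ * b ∈ N ⊔ (PushoutI.base φ).range := QuotientGroup.leftRel_apply.1 hab
    rw [← SetLike.mem_coe, Subgroup.normal_mul] at h1
    obtain ⟨n, hn, c, hc, hnc⟩ := h1
    refine (Quotient.sound (MulAction.orbitRel_apply.2 ?_)).symm
    refine ⟨⟨a * n * a⁻¹, Subgroup.Normal.conj_mem ‹_› n hn a⟩, ?_⟩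
    change ((a * n * a⁻¹ * a : PushoutI φ) : TreeEdge φ) = b
    rw [QuotientGroup.eq, inv_mul_cancel_right]
    have : b = a * (n * c) := by
      dsimp only at hnc
      rw [hnc, mul_inv_cancel_left]
    rw [this]
    simpa [mul_assoc] using hc
  · intro q
    induction q using Quotient.inductionOn with
    | h e =>
      induction e using QuotientGroup.induction_on with
      | H g => exact ⟨Quotient.mk _ g, rfl⟩

end Edges

section Cocompact

variable {H : Type*} [Group H] {K : Bool → Type*} [∀ i, Group (K i)] {φ : ∀ i, H →* K i}

/-- The image of an edge in the set of cosets of the product of `N` and the amalgamated subgroup. -/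
def edgeClass (N : Subgroup (PushoutI φ)) :
    TreeEdge φ → PushoutI φ ⧸ (N ⊔ (PushoutI.base φ).range) :=
  Quotient.map' id fun a b hab => by
    rw [QuotientGroup.leftRel_apply] at hab ⊢
    exact Subgroup.mem_sup_right hab

theorem edgeClass_smul (N : Subgroup (PushoutI φ)) (g : PushoutI φ) (e : TreeEdge φ) :
    edgeClass N (g • e) = g • edgeClass N e := by
  induction e using QuotientGroup.induction_on with
  | H a => rfl

theorem smul_eq_of_mem_normal (N : Subgroup (PushoutI φ)) [N.Normal] {n : PushoutI φ} (hn : n ∈ N)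
    (ω : PushoutI φ ⧸ (N ⊔ (PushoutI.base φ).range)) : n • ω = ω := by
  induction ω using QuotientGroup.induction_on with
  | H a =>
    change ((n * a : PushoutI φ) : PushoutI φ ⧸ (N ⊔ (PushoutI.base φ).range)) = a
    rw [eq_comm, QuotientGroup.eq]
    refine Subgroup.mem_sup_left ?_
    have := Subgroup.Normal.conj_mem ‹_› n hn a⁻¹
    simpa [mul_assoc] using this

/-- A set of edge classes supports `N` if, up to a coboundary, the restriction of `pathChain` to `N`
takes values in the chains on edges with class in that set. -/
def Supports (N : Subgroup (PushoutI φ))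
    (W : Set (PushoutI φ ⧸ (N ⊔ (PushoutI.base φ).range))) : Prop :=
  ∃ x : TreeEdge φ →₀ ℤ, ∀ n ∈ N, ∀ e : TreeEdge φ, edgeClass N e ∉ W →
    (pathChain n + permRep (PushoutI φ) _ n x - x) e = 0

theorem exists_finite_supports (N : Subgroup (PushoutI φ)) [N.Normal] (hN : N.FG) :
    ∃ W, W.Finite ∧ Supports N W := by
  classical
  obtain ⟨S, rfl⟩ := hN
  set N := Subgroup.closure (S : Set (PushoutI φ))
  refine ⟨edgeClass N '' ⋃ s ∈ S, ((pathChain s).support : Set (TreeEdge φ)), ?_, 0, ?_⟩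
  · exact (S.finite_toSet.biUnion fun s _ => Finset.finite_toSet _).image _
  · set W := edgeClass N '' ⋃ s ∈ S, ((pathChain s).support : Set (TreeEdge φ))
    have hW : ∀ n ∈ N, ∀ e, edgeClass N e ∉ W → edgeClass N (n⁻¹ • e) ∉ W := by
      intro n hn e he
      rwa [edgeClass_smul, smul_eq_of_mem_normal N (N.inv_mem hn)]
    suffices h : ∀ n ∈ N, ∀ e, edgeClass N e ∉ W → pathChain n e = 0 by
      intro n hn e he
      rw [map_zero, add_zero, sub_zero, h n hn e he]
    intro n hn
    induction hn using Subgroup.closure_induction with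
    | mem s hs =>
      intro e he
      by_contra h0
      exact he ⟨e, Set.mem_biUnion hs (by simpa using h0), rfl⟩
    | one => simp [pathChain_one]
    | mul a b ha hb iha ihb =>
      intro e he
      rw [pathChain_mul, Finsupp.add_apply, iha e he, permRep_apply, ihb _ (hW a ha e he),
        add_zero]
    | inv a ha iha =>
      intro e he
      have h1 := iha (a • e) (by rwa [edgeClass_smul, smul_eq_of_mem_normal N ha])
      have h2 := DFunLike.congr_fun (permRep_pathChain_inv a) (a • e)
      rwa [permRep_apply, inv_smul_smul, Finsupp.neg_apply, h1, neg_zero] at h2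

theorem Supports.inter {N : Subgroup (PushoutI φ)} [N.Normal]
    {W W' : Set (PushoutI φ ⧸ (N ⊔ (PushoutI.base φ).range))} (h : Supports N W)
    (h' : Supports N W') : Supports N (W ∩ W') := by
  classical
  obtain ⟨x, hx⟩ := h
  obtain ⟨y, hy⟩ := h'
  let z := (x - y).filter fun e => edgeClass N e ∉ W'
  refine ⟨x - z, fun n hn e he => ?_⟩
  have hcls : edgeClass N (n⁻¹ • e) = edgeClass N e := by
    rw [edgeClass_smul, smul_eq_of_mem_normal N (N.inv_mem hn)]
  have h1 := hx n hn e
  have h2 := hy n hn e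
  simp only [map_sub, Finsupp.add_apply, Finsupp.sub_apply, permRep_apply] at h1 h2 ⊢
  by_cases hW' : edgeClass N e ∈ W'
  · have hW : edgeClass N e ∉ W := fun hW => he ⟨hW, hW'⟩
    have hz : z e = 0 := Finsupp.filter_apply_neg _ _ (by simpa using hW')
    have hz' : z (n⁻¹ • e) = 0 := Finsupp.filter_apply_neg _ _ (by simpa [hcls] using hW')
    have := h1 hW
    rw [hz, hz']
    linarith
  · have hz : z e = x e - y e := Finsupp.filter_apply_pos _ _ hW'
    have hz' : z (n⁻¹ • e) = x (n⁻¹ • e) - y (n⁻¹ • e) :=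
      Finsupp.filter_apply_pos _ _ (by rwa [hcls])
    have := h2 hW'
    rw [hz, hz']
    linarith

open scoped Pointwise in
theorem Supports.smul {N : Subgroup (PushoutI φ)} [N.Normal]
    {W : Set (PushoutI φ ⧸ (N ⊔ (PushoutI.base φ).range))} (h : Supports N W) (g : PushoutI φ) :
    Supports N (g • W) := by
  obtain ⟨x, hx⟩ := h
  refine ⟨permRep (PushoutI φ) _ g x + pathChain g, fun n hn e he => ?_⟩
  have hm : g⁻¹ * n * g ∈ N := by
    simpa using Subgroup.Normal.conj_mem ‹_› n hn g⁻¹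
  have h1 := hx _ hm (g⁻¹ • e) (by
    rwa [edgeClass_smul, ← Set.mem_smul_set_iff_inv_smul_mem])
  have h2 : permRep (PushoutI φ) (TreeEdge φ) g
      (pathChain (g⁻¹ * n * g) + permRep (PushoutI φ) _ (g⁻¹ * n * g) x - x) =
        pathChain n + permRep (PushoutI φ) _ n (permRep (PushoutI φ) _ g x + pathChain g) -
          (permRep (PushoutI φ) _ g x + pathChain g) := by
    have h3 : pathChain (g * (g⁻¹ * n * g)) = pathChain (n * g) := by congr 1; group
    rw [pathChain_mul, pathChain_mul n g] at h3
    rw [map_sub, map_add, map_add, ← permRep_mul_apply, ← permRep_mul_apply,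
      show g * (g⁻¹ * n * g) = n * g by group, eq_sub_of_add_eq h3]
    abel
  rw [← h2, permRep_apply, h1]

/-- Either the normal finitely generated subgroup `N` acts on the edges with finitely many orbits,
or `pathChain` has bounded support on `N`. -/
theorem finiteIndex_or_bounded_pathChain (N : Subgroup (PushoutI φ)) [N.Normal] (hN : N.FG) :
    (N ⊔ (PushoutI.base φ).range).FiniteIndex ∨
      ∃ B : ℕ, ∀ n ∈ N, (pathChain n).support.card ≤ B := by
  classical
  let P : ℕ → Prop := fun k => ∃ W, W.Finite ∧ Supports N W ∧ W.ncard = k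
  have hP : ∃ k, P k := by
    obtain ⟨W, hW, h⟩ := exists_finite_supports N hN
    exact ⟨_, W, hW, h, rfl⟩
  obtain ⟨W, hWfin, hW, hcard⟩ := Nat.find_spec hP
  have hmin : ∀ W', Supports N W' → W ⊆ W' := by
    intro W' hW'
    have h1 : Nat.find hP ≤ (W ∩ W').ncard :=
      Nat.find_min' hP ⟨_, hWfin.inter_of_left _, hW.inter hW', rfl⟩
    rw [← hcard] at h1
    exact Set.inter_eq_left.1 (Set.eq_of_subset_of_ncard_le Set.inter_subset_left h1 hWfin)
  rcases W.eq_empty_or_nonempty with rfl | ⟨ω, hω⟩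
  · right
    obtain ⟨x, hx⟩ := hW
    refine ⟨x.support.card + x.support.card, fun n hn => ?_⟩
    have h1 : pathChain n = x - permRep (PushoutI φ) _ n x := by
      ext e
      have := hx n hn e (Set.notMem_empty _)
      simp only [Finsupp.add_apply, Finsupp.sub_apply] at this ⊢
      linarith
    have h2 : (permRep (PushoutI φ) _ n x).support ⊆ x.support.image (n • ·) :=
      Finsupp.mapDomain_support
    rw [h1]
    calc (x - permRep (PushoutI φ) _ n x).support.card
        ≤ (x.support ∪ x.support.image (n • ·)).card :=
          Finset.card_le_card (Finsupp.support_sub.trans (Finset.union_subset_union_right h2))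
      _ ≤ x.support.card + (x.support.image (n • ·)).card := Finset.card_union_le _ _
      _ ≤ _ := Nat.add_le_add_left Finset.card_image_le _
  · left
    have huniv : W = Set.univ := by
      rw [Set.eq_univ_iff_forall]
      intro ω'
      obtain ⟨g, rfl⟩ := MulAction.exists_smul_eq (PushoutI φ) ω' ω
      have := hmin _ (hW.smul g) hω
      exact (Set.smul_mem_smul_set_iff (a := g)).1 this
    rw [huniv, Set.finite_univ_iff] at hWfin
    exact Subgroup.finiteIndex_of_finite_quotient

end Cocompact

section ReducedWords

variable {H : Type*} [Group H] {K : Bool → Type*} [∀ i, Group (K i)]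

/-- `IsAlternating φ i j n g` says that `g` is a product of `n` letters taken alternately from the
two factors outside the amalgamated subgroup, the first in `K i` and the last in `K j`. -/
inductive IsAlternating (φ : ∀ i, H →* K i) : Bool → Bool → ℕ → PushoutI φ → Prop
  | of (i : Bool) (x : K i) (hx : x ∉ (φ i).range) : IsAlternating φ i i 1 (PushoutI.of i x)
  | cons (i j : Bool) (n : ℕ) (x : K i) (hx : x ∉ (φ i).range) (g : PushoutI φ)
      (hg : IsAlternating φ (!i) j n g) : IsAlternating φ i j (n + 1) (PushoutI.of i x * g)

variable {φ : ∀ i, H →* K i}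

theorem IsAlternating.pos {i j n} {g : PushoutI φ} (h : IsAlternating φ i j n g) : 0 < n := by
  cases h <;> simp

theorem IsAlternating.exists_word {i j n} {g : PushoutI φ} (h : IsAlternating φ i j n g) :
    ∃ w : CoprodI.Word K, PushoutI.Reduced φ w ∧ w.fstIdx = some i ∧
      PushoutI.ofCoprodI w.prod = g := by
  induction h with
  | of i x hx =>
    have h1 : x ≠ 1 := fun h => hx (h ▸ one_mem _)
    have h2 : (CoprodI.Word.empty : CoprodI.Word K).fstIdx ≠ some i := by
      simp [CoprodI.Word.fstIdx, CoprodI.Word.empty]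
    refine ⟨CoprodI.Word.cons x .empty h2 h1, ?_, by simp, by simp⟩
    intro l hl
    obtain rfl : l = ⟨i, x⟩ := by simpa [CoprodI.Word.cons, CoprodI.Word.empty] using hl
    exact hx
  | cons i j n x hx g hg ih =>
    obtain ⟨w, hw, hfst, rfl⟩ := ih
    have h1 : x ≠ 1 := fun h => hx (h ▸ one_mem _)
    refine ⟨CoprodI.Word.cons x w (by simp [hfst]) h1, ?_, by simp, by simp⟩
    intro l hl
    rcases List.mem_cons.1 hl with rfl | hl
    · exact hx
    · exact hw l hl

theorem IsAlternating.notMem_range (hφ : ∀ i, Function.Injective (φ i)) {i j n} {g : PushoutI φ}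
    (h : IsAlternating φ i j n g) : g ∉ (PushoutI.base φ).range := by
  intro hg
  obtain ⟨w, hw, hfst, rfl⟩ := h.exists_word
  have := hw.eq_empty_of_mem_range hφ hg
  subst this
  simp [CoprodI.Word.fstIdx, CoprodI.Word.empty] at hfst

theorem IsAlternating.mul {i j k n m} {g h : PushoutI φ} (hg : IsAlternating φ i j n g)
    (hh : IsAlternating φ (!j) k m h) : IsAlternating φ i k (n + m) (g * h) := by
  induction hg with
  | of i x hx => rw [add_comm]; exact .cons i k m x hx h hh
  | cons i j n x hx g hg ih =>
    rw [mul_assoc, add_right_comm]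
    exact .cons i k _ x hx _ (ih hh)

theorem IsAlternating.base_mul {i j n} {g : PushoutI φ} (hg : IsAlternating φ i j n g) (h : H) :
    IsAlternating φ i j n (PushoutI.base φ h * g) := by
  cases hg with
  | of i x hx =>
    rw [← PushoutI.of_apply_eq_base φ i, ← map_mul]
    exact .of i _ fun hxh =>
      hx ((Subgroup.mul_mem_cancel_left _ (MonoidHom.mem_range.2 ⟨h, rfl⟩)).1 hxh)
  | cons i j n x hx g hg =>
    rw [← PushoutI.of_apply_eq_base φ i, ← mul_assoc, ← map_mul]
    exact .cons i _ _ _ (fun hxh =>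
      hx ((Subgroup.mul_mem_cancel_left _ (MonoidHom.mem_range.2 ⟨h, rfl⟩)).1 hxh)) _ hg

theorem IsAlternating.of_mul {i j n} {g : PushoutI φ} (hg : IsAlternating φ i j n g) (k : Bool)
    (x : K k) : PushoutI.of k x * g ∈ (PushoutI.base φ).range ∨
      ∃ i' j' n', IsAlternating φ i' j' n' (PushoutI.of k x * g) := by
  by_cases hx : x ∈ (φ k).range
  · obtain ⟨h, rfl⟩ := hx
    rw [PushoutI.of_apply_eq_base]
    exact .inr ⟨_, _, _, hg.base_mul h⟩
  rcases Bool.eq_or_eq_not i k with rfl | rfl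
  · cases hg with
    | of i y hy =>
      rw [← map_mul]
      by_cases hxy : x * y ∈ (φ i).range
      · obtain ⟨h, hh⟩ := hxy
        exact .inl ⟨h, by rw [← hh, PushoutI.of_apply_eq_base]⟩
      · exact .inr ⟨_, _, _, .of i _ hxy⟩
    | cons i j n y hy g hg =>
      rw [← mul_assoc, ← map_mul]
      by_cases hxy : x * y ∈ (φ i).range
      · obtain ⟨h, hh⟩ := hxy
        rw [← hh, PushoutI.of_apply_eq_base]
        exact .inr ⟨_, _, _, hg.base_mul h⟩
      · exact .inr ⟨_, _, _, .cons i _ _ _ hxy _ hg⟩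
  · exact .inr ⟨_, _, _, .cons _ _ _ x hx _ hg⟩

theorem mem_range_or_isAlternating (g : PushoutI φ) :
    g ∈ (PushoutI.base φ).range ∨ ∃ i j n, IsAlternating φ i j n g := by
  suffices h : ∀ g' : PushoutI φ,
      (g' ∈ (PushoutI.base φ).range ∨ ∃ i j n, IsAlternating φ i j n g') →
        (g * g' ∈ (PushoutI.base φ).range ∨ ∃ i j n, IsAlternating φ i j n (g * g')) by
    simpa using h 1 (.inl (one_mem _))
  induction g using PushoutI.induction_of with
  | of i x =>
    rintro g' (⟨h, rfl⟩ | ⟨_, _, _, h⟩)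
    · rw [← PushoutI.of_apply_eq_base φ i, ← map_mul]
      by_cases hx : x * φ i h ∈ (φ i).range
      · obtain ⟨h', hh⟩ := hx
        exact .inl ⟨h', by rw [← hh, PushoutI.of_apply_eq_base]⟩
      · exact .inr ⟨_, _, _, .of i _ hx⟩
    · exact h.of_mul i x
  | mul x y hx hy =>
    intro g' hg'
    rw [mul_assoc]
    exact hx _ (hy _ hg')

theorem smul_baseEdge_eq_iff (g : PushoutI φ) :
    g • baseEdge φ = baseEdge φ ↔ g ∈ (PushoutI.base φ).range := by
  have h : g • baseEdge φ = (g : TreeEdge φ) :=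
    congrArg (fun a : PushoutI φ => (a : TreeEdge φ)) (mul_one g)
  rw [h, baseEdge, eq_comm, QuotientGroup.eq, inv_one, one_mul]

theorem pathChain_of_true (x : K true) :
    pathChain (PushoutI.of true x : PushoutI φ) = Finsupp.single (baseEdge φ) 1 -
      Finsupp.single ((PushoutI.of true x : PushoutI φ) • baseEdge φ) 1 := by
  simp [pathChain_of, basePath]

theorem pathChain_of_false (x : K false) : pathChain (PushoutI.of false x : PushoutI φ) = 0 := by
  simp [pathChain_of, basePath]

theorem IsAlternating.exists_of_pathChain_ne_zero {i j n} {g : PushoutI φ}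
    (h : IsAlternating φ i j n g) (e : TreeEdge φ) (he : pathChain g e ≠ 0) :
    (i = true ∧ e = baseEdge φ) ∨
      ∃ (j' : Bool) (n' : ℕ) (p : PushoutI φ), IsAlternating φ i j' n' p ∧ e = p • baseEdge φ := by
  classical
  have single_cases : ∀ (e a b : TreeEdge φ),
      (Finsupp.single a (1 : ℤ) - Finsupp.single b 1 : TreeEdge φ →₀ ℤ) e ≠ 0 → e = a ∨ e = b := by
    intro e a b hab
    by_contra! hne
    exact hab (by simp [hne.1.symm, hne.2.symm])
  induction h generalizing e with
  | of i x hx =>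
    cases i with
    | false => simp [pathChain_of_false] at he
    | true =>
      rw [pathChain_of_true] at he
      rcases single_cases _ _ _ he with rfl | rfl
      · exact .inl ⟨rfl, rfl⟩
      · exact .inr ⟨_, _, _, .of _ x hx, rfl⟩
  | cons i j n x hx g hg ih =>
    rw [pathChain_mul, Finsupp.add_apply, permRep_apply] at he
    by_cases h0 : pathChain g ((PushoutI.of i x : PushoutI φ)⁻¹ • e) = 0
    · rw [h0, zero_add] at he
      cases i with
      | false => simp [pathChain_of_false] at he
      | true =>
        rw [pathChain_of_true] at he
        rcases single_cases _ _ _ he with rfl | rfl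
        · exact .inl ⟨rfl, rfl⟩
        · exact .inr ⟨_, _, _, .of _ x hx, rfl⟩
    · right
      rcases ih _ h0 with ⟨_, h⟩ | ⟨j', n', p, hp, h⟩
      · exact ⟨_, _, _, .of _ x hx, by rw [← h, smul_inv_smul]⟩
      · exact ⟨_, _, _, .cons _ _ _ x hx _ hp, by rw [mul_smul, ← h, smul_inv_smul]⟩

theorem IsAlternating.le_card_support (hφ : ∀ i, Function.Injective (φ i)) {i j n}
    {g : PushoutI φ} (h : IsAlternating φ i j n g) :
    n ≤ 2 * (pathChain g).support.card + if i then 0 else 1 := by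
  classical
  have himage : ∀ (x g : PushoutI φ), (permRep (PushoutI φ) _ x (pathChain g)).support =
      (pathChain g).support.image (x • ·) := by
    intro x g
    exact Finsupp.mapDomain_support_of_injective (MulAction.injective x) _
  induction h with
  | of i x hx =>
    cases i with
    | false => simp
    | true =>
      rw [if_pos rfl, add_zero]
      suffices h : 0 < (pathChain (PushoutI.of true x : PushoutI φ)).support.card by omega
      rw [Finset.card_pos, Finsupp.support_nonempty_iff, pathChain_of_true, sub_ne_zero]
      intro h0
      have h1 := Finsupp.single_left_injective one_ne_zero h0
      rw [eq_comm, smul_baseEdge_eq_iff] at h1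
      exact (IsAlternating.of true x hx).notMem_range hφ h1
  | cons i j n x hx g hg ih =>
    cases i with
    | false =>
      rw [pathChain_mul, pathChain_of_false, add_zero, himage,
        Finset.card_image_of_injective _ (MulAction.injective _)]
      simpa using ih
    | true =>
      have hxC := (IsAlternating.of true x hx).notMem_range hφ
      have hne : (PushoutI.of true x : PushoutI φ) • baseEdge φ ≠ baseEdge φ := fun h =>
        hxC ((smul_baseEdge_eq_iff _).1 h)
      have h1 : pathChain g (baseEdge φ) = 0 := by
        by_contra h0
        rcases hg.exists_of_pathChain_ne_zero _ h0 with ⟨h, _⟩ | ⟨j', n', p, hp, h⟩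
        · simp at h
        · exact hp.notMem_range hφ ((smul_baseEdge_eq_iff _).1 h.symm)
      have h2 : pathChain g ((PushoutI.of true x : PushoutI φ)⁻¹ • baseEdge φ) = 0 := by
        by_contra h0
        rcases hg.exists_of_pathChain_ne_zero _ h0 with ⟨h, _⟩ | ⟨j', n', p, hp, h⟩
        · simp at h
        · rw [inv_smul_eq_iff, smul_smul, eq_comm, smul_baseEdge_eq_iff] at h
          exact (IsAlternating.cons _ _ _ x hx _ hp).notMem_range hφ h
      have hsub : insert (baseEdge φ) ((pathChain g).support.image
          ((PushoutI.of true x : PushoutI φ) • ·)) ⊆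
            (pathChain (PushoutI.of true x * g)).support := by
        intro e he
        rw [Finsupp.mem_support_iff, pathChain_mul, Finsupp.add_apply, permRep_apply,
          pathChain_of_true]
        rcases Finset.mem_insert.1 he with rfl | he
        · rw [h2]
          simp [hne]
        · obtain ⟨e, he', rfl⟩ := Finset.mem_image.1 he
          rw [Finsupp.mem_support_iff] at he'
          have h3 : baseEdge φ ≠ (PushoutI.of true x : PushoutI φ) • e := by
            intro h
            rw [← inv_smul_eq_iff] at h
            exact he' (h ▸ h2)
          have h4 : baseEdge φ ≠ e := by
            rintro rfl
            exact he' h1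
          simpa [Finsupp.single_apply, h3, h4] using he'
      have hcard := Finset.card_le_card hsub
      rw [Finset.card_insert_of_notMem, Finset.card_image_of_injective _ (MulAction.injective _)]
        at hcard
      · simp only [Bool.not_true, Bool.false_eq_true, if_false, if_true] at ih ⊢
        omega
      · intro h
        obtain ⟨e, he, h⟩ := Finset.mem_image.1 h
        rw [Finsupp.mem_support_iff] at he
        rw [← eq_inv_smul_iff] at h
        exact he (h ▸ h2)

theorem le_range_of_bounded_pathChain (hφ : ∀ i, Function.Injective (φ i))
    (hns : ∀ i, ∃ x : K i, x ∉ (φ i).range) (N : Subgroup (PushoutI φ)) [N.Normal] {B : ℕ}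
    (hB : ∀ n ∈ N, (pathChain n).support.card ≤ B) : N ≤ (PushoutI.base φ).range := by
  intro g hg
  rcases mem_range_or_isAlternating g with h | ⟨i, j, n, h⟩
  · exact h
  exfalso
  have hlong : ∀ m : ℕ, ∃ i j n, ∃ g ∈ N, m ≤ n ∧ IsAlternating φ i j n g := by
    intro m
    induction m with
    | zero => exact ⟨i, j, n, g, hg, Nat.zero_le _, h⟩
    | succ m ih =>
      obtain ⟨i, j, n, g, hg, hmn, h⟩ := ih
      rcases Bool.eq_or_eq_not i j with rfl | rfl
      · obtain ⟨y, hy⟩ := hns (!i)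
        refine ⟨!i, !i, n + 1 + 1, PushoutI.of (!i) y * g * (PushoutI.of (!i) y)⁻¹,
          Subgroup.Normal.conj_mem ‹_› _ hg _, by omega, ?_⟩
        refine (IsAlternating.cons (!i) i n y hy g (by simpa using h)).mul ?_
        rw [← map_inv]
        exact .of _ _ (by simpa using hy)
      · exact ⟨!j, j, n + n, g * g, N.mul_mem hg hg, by have := h.pos; omega, h.mul h⟩
  obtain ⟨i, j, n, g, hg, hn, h⟩ := hlong (2 * B + 2)
  have h1 := h.le_card_support hφ
  have h2 := hB g hg
  split_ifs at h1 <;> omega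

end ReducedWords

section FreeCase

variable {H : Type*} [Group H] {K : Bool → Type*} [∀ i, Group (K i)] {φ : ∀ i, H →* K i}
  (N : Subgroup (PushoutI φ))

/-- The orbits of the amalgamated subgroup on the cosets of `N`. -/
abbrev BaseOrbit := MulAction.orbitRel.Quotient (PushoutI.base φ).range (PushoutI φ ⧸ N)

variable {N} in
/-- The orbit of a coset of `N` under the amalgamated subgroup. -/
def baseOrbit (y : PushoutI φ ⧸ N) : BaseOrbit N := Quotient.mk _ y

/-- The action of an amalgamated product on the trivial covering of the cosets of `N`. -/
def trivialAction : PushoutI φ →* Equiv.Perm ((PushoutI φ ⧸ N) × FreeGroup (BaseOrbit N)) where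
  toFun g := (MulAction.toPerm g).prodCongr (Equiv.refl _)
  map_one' := by ext1 p; exact Prod.ext (one_smul (PushoutI φ) p.1) rfl
  map_mul' g h := by ext1 p; exact Prod.ext (mul_smul g h p.1) rfl

/-- The change of trivialization used over `K i`. -/
def twist (i : Bool) : Equiv.Perm ((PushoutI φ ⧸ N) × FreeGroup (BaseOrbit N)) :=
  Equiv.prodShear (Equiv.refl _)
    fun y => Equiv.mulLeft (if i then FreeGroup.of (baseOrbit y) else 1)

/-- An action of an amalgamated product on a covering of the cosets of `N`, trivialized by `twist`
over `K i`. -/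
noncomputable def coveringAction :
    PushoutI φ →* Equiv.Perm ((PushoutI φ ⧸ N) × FreeGroup (BaseOrbit N)) :=
  PushoutI.lift
    (fun i => (MulAut.conj (twist N i)).toMonoidHom.comp
      ((trivialAction N).comp (PushoutI.of i)))
    ((trivialAction N).comp (PushoutI.base φ)) (fun i => by
      ext1 h
      change twist N i * trivialAction N (PushoutI.of i (φ i h)) * (twist N i)⁻¹ =
        trivialAction N (PushoutI.base φ h)
      rw [mul_inv_eq_iff_eq_mul, PushoutI.of_apply_eq_base]
      ext1 p
      refine Prod.ext rfl ?_
      have h1 : baseOrbit (PushoutI.base φ h • p.1) = baseOrbit p.1 :=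
        Quotient.sound (MulAction.orbitRel_apply.2 ⟨⟨_, h, rfl⟩, rfl⟩)
      change (if i then FreeGroup.of (baseOrbit (PushoutI.base φ h • p.1)) else 1) * p.2 =
        (if i then FreeGroup.of (baseOrbit p.1) else 1) * p.2
      rw [h1])

/-- The cocycle describing `coveringAction`. -/
noncomputable def coveringCocycle (g : PushoutI φ) (y : PushoutI φ ⧸ N) :
    FreeGroup (BaseOrbit N) :=
  (coveringAction N g (y, 1)).2

variable {N}

theorem coveringAction_of (i : Bool) (x : K i) (y : PushoutI φ ⧸ N) (f : FreeGroup (BaseOrbit N)) :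
    coveringAction N (PushoutI.of i x) (y, f) = ((PushoutI.of i x : PushoutI φ) • y,
      (if i then FreeGroup.of (baseOrbit ((PushoutI.of i x : PushoutI φ) • y)) else 1) *
        ((if i then FreeGroup.of (baseOrbit y) else 1)⁻¹ * f)) := by
  rw [coveringAction, PushoutI.lift_of]
  rfl

theorem coveringAction_apply (g : PushoutI φ) (y : PushoutI φ ⧸ N)
    (f : FreeGroup (BaseOrbit N)) :
    coveringAction N g (y, f) = (g • y, coveringCocycle N g y * f) := by
  induction g using PushoutI.induction_of generalizing y f with
  | of i x => simp only [coveringCocycle, coveringAction_of, mul_one, mul_assoc]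
  | mul g h hg hh =>
    rw [coveringCocycle, map_mul, Equiv.Perm.mul_apply, Equiv.Perm.mul_apply, hh, hh, hg, hg,
      mul_smul, mul_one, mul_assoc]

theorem coveringCocycle_mul (g h : PushoutI φ) (y : PushoutI φ ⧸ N) :
    coveringCocycle N (g * h) y = coveringCocycle N g (h • y) * coveringCocycle N h y := by
  rw [coveringCocycle, map_mul, Equiv.Perm.mul_apply, coveringAction_apply, coveringAction_apply,
    mul_one]

theorem coveringCocycle_of_true (x : K true) (y : PushoutI φ ⧸ N) :
    coveringCocycle N (PushoutI.of true x) y =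
      FreeGroup.of (baseOrbit ((PushoutI.of true x : PushoutI φ) • y)) *
        (FreeGroup.of (baseOrbit y))⁻¹ := by
  rw [coveringCocycle, coveringAction_of, if_pos rfl, if_pos rfl, mul_one]

theorem coveringCocycle_of_false (x : K false) (y : PushoutI φ ⧸ N) :
    coveringCocycle N (PushoutI.of false x) y = 1 := by
  rw [coveringCocycle, coveringAction_of, if_neg Bool.false_ne_true, if_neg Bool.false_ne_true]
  simp

theorem baseOrbit_smul_ne [N.Normal] {i : Bool} (hi : N.comap (PushoutI.of (φ := φ) i) = ⊥)
    {x : K i} (hx : x ∉ (φ i).range) (y : PushoutI φ ⧸ N) :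
    baseOrbit ((PushoutI.of i x : PushoutI φ) • y) ≠ baseOrbit y := by
  intro h
  obtain ⟨⟨_, c, rfl⟩, hc⟩ := MulAction.orbitRel_apply.1 (Quotient.exact h)
  induction y using QuotientGroup.induction_on with
  | H g =>
    have h1 : ((PushoutI.base φ c * g : PushoutI φ) : PushoutI φ ⧸ N) =
      ((PushoutI.of i x * g : PushoutI φ) : PushoutI φ ⧸ N) := hc
    rw [QuotientGroup.eq] at h1
    have h2 := Subgroup.Normal.conj_mem ‹_› _ h1 g
    rw [← PushoutI.of_apply_eq_base φ i] at h2
    have h3 : (φ i c)⁻¹ * x ∈ N.comap (PushoutI.of (φ := φ) i) := by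
      rw [Subgroup.mem_comap]
      simpa [mul_assoc] using h2
    rw [hi, Subgroup.mem_bot, inv_mul_eq_one] at h3
    exact hx ⟨c, h3⟩

/-- The reduced word of `f` starts with the generator `q`. -/
def StartsWith {α : Type*} (q : α) (f : FreeGroup α) : Prop :=
  ∃ L, FreeGroup.IsReduced ((q, true) :: L) ∧ f = FreeGroup.mk ((q, true) :: L)

theorem StartsWith.ne_one {α : Type*} {q : α} {f : FreeGroup α} (h : StartsWith q f) : f ≠ 1 := by
  classical
  obtain ⟨L, hL, rfl⟩ := h
  rw [Ne, ← FreeGroup.toWord_eq_nil_iff, FreeGroup.toWord_mk, hL.reduce_eq]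
  exact List.cons_ne_nil _ _

theorem StartsWith.of_mul_inv {α : Type*} {p q : α} (h : p ≠ q) :
    StartsWith p (FreeGroup.of p * (FreeGroup.of q)⁻¹) :=
  ⟨[(q, false)], by simp [h], rfl⟩

theorem StartsWith.of_mul_inv_mul {α : Type*} {p q r : α} {f : FreeGroup α} (hpq : p ≠ q)
    (hqr : r ≠ q) (hf : StartsWith r f) :
    StartsWith p (FreeGroup.of p * (FreeGroup.of q)⁻¹ * f) := by
  obtain ⟨L, hL, rfl⟩ := hf
  exact ⟨(q, false) :: (r, true) :: L, by simp [hpq, hqr.symm, hL], rfl⟩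

theorem IsAlternating.startsWith [N.Normal]
    (hN : ∀ i, N.comap (PushoutI.of (φ := φ) i) = ⊥) {i j n} {g : PushoutI φ}
    (h : IsAlternating φ i j n g) (y : PushoutI φ ⧸ N) :
    if i then StartsWith (baseOrbit (g • y)) (coveringCocycle N g y)
    else (n = 1 ∧ coveringCocycle N g y = 1) ∨
      ∃ q, q ≠ baseOrbit (g • y) ∧ StartsWith q (coveringCocycle N g y) := by
  induction h with
  | of i x hx =>
    cases i with
    | false => exact .inl ⟨rfl, coveringCocycle_of_false x y⟩
    | true =>
      rw [if_pos rfl, coveringCocycle_of_true]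
      exact .of_mul_inv (baseOrbit_smul_ne (hN _) hx y)
  | cons i j n x hx g hg ih =>
    rw [coveringCocycle_mul, mul_smul]
    have hne := baseOrbit_smul_ne (hN _) hx (g • y)
    cases i with
    | false =>
      rw [coveringCocycle_of_false, one_mul]
      exact .inr ⟨_, hne.symm, ih⟩
    | true =>
      rw [if_pos rfl, coveringCocycle_of_true]
      rcases ih with ⟨_, h⟩ | ⟨q, hq, h⟩
      · rw [h, mul_one]
        exact .of_mul_inv hne
      · exact .of_mul_inv_mul hne hq h

/-- The homomorphism to a free group defined by the covering cocycle. -/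
noncomputable def coveringHom (N : Subgroup (PushoutI φ)) : N →* FreeGroup (BaseOrbit N) where
  toFun n := coveringCocycle N n ((1 : PushoutI φ) : PushoutI φ ⧸ N)
  map_one' := by rw [coveringCocycle, OneMemClass.coe_one, map_one]; rfl
  map_mul' n m := by
    have h : (m : PushoutI φ) • ((1 : PushoutI φ) : PushoutI φ ⧸ N) = (1 : PushoutI φ) := by
      change ((m * 1 : PushoutI φ) : PushoutI φ ⧸ N) = (1 : PushoutI φ)
      rw [mul_one, eq_comm, QuotientGroup.eq, inv_one, one_mul]
      exact m.2
    rw [Subgroup.coe_mul, coveringCocycle_mul, h]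

theorem coveringHom_injective [N.Normal] (hN : ∀ i, N.comap (PushoutI.of (φ := φ) i) = ⊥) :
    Function.Injective (coveringHom N) := by
  rw [injective_iff_map_eq_one]
  rintro ⟨g, hg⟩ h0
  have hof : ∀ i (x : K i), g = PushoutI.of i x → g = 1 := by
    rintro i x rfl
    have : x ∈ N.comap (PushoutI.of (φ := φ) i) := hg
    rw [hN, Subgroup.mem_bot] at this
    rw [this, map_one]
  refine Subtype.ext ?_
  rcases mem_range_or_isAlternating g with ⟨c, hc⟩ | ⟨i, j, n, h⟩
  · exact hof true (φ true c) (by rw [PushoutI.of_apply_eq_base, hc])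
  · have h1 := h.startsWith hN ((1 : PushoutI φ) : PushoutI φ ⧸ N)
    have h0' : coveringCocycle N g ((1 : PushoutI φ) : PushoutI φ ⧸ N) = 1 := h0
    rw [h0'] at h1
    cases h with
    | of i x hx => exact hof i x rfl
    | cons i j n x hx g hg' =>
      have := hg'.pos
      cases i with
      | true => exact absurd rfl (StartsWith.ne_one h1)
      | false =>
        rcases h1 with ⟨h1, _⟩ | ⟨q, _, h1⟩
        · omega
        · exact absurd rfl h1.ne_one

/-- A normal subgroup of an amalgamated product meeting the factors trivially is free. -/
theorem isFreeGroup_of_comap_of_eq_bot [N.Normal]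
    (hN : ∀ i, N.comap (PushoutI.of (φ := φ) i) = ⊥) : IsFreeGroup N :=
  IsFreeGroup.ofMulEquiv (MonoidHom.ofInjective (coveringHom_injective hN)).symm

end FreeCase

section Assembly

variable {H : Type*} [Group H] {K : Bool → Type*} [∀ i, Group (K i)] {φ : ∀ i, H →* K i}

theorem Monoid.PushoutI.of_not_surjective {i : Bool} (hi : Function.Surjective (φ i)) :
    Function.Surjective (PushoutI.of (φ := φ) (!i)) := by
  intro g
  induction g using PushoutI.induction_of with
  | of j x =>
    rcases Bool.eq_or_eq_not j i with rfl | rfl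
    · obtain ⟨h, rfl⟩ := hi x
      exact ⟨φ (!j) h, by rw [PushoutI.of_apply_eq_base, PushoutI.of_apply_eq_base]⟩
    · exact ⟨x, rfl⟩
  | mul x y hx hy =>
    obtain ⟨a, rfl⟩ := hx
    obtain ⟨b, rfl⟩ := hy
    exact ⟨a * b, map_mul _ _ _⟩

/-- A normal subgroup has finite index if its preimage in a factor has finite index and its product
with the amalgamated subgroup has finite index. -/
theorem finiteIndex_of_comap_of {N : Subgroup (PushoutI φ)} [N.Normal] {i : Bool}
    (h : (N.comap (PushoutI.of (φ := φ) i)).FiniteIndex)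
    (hC : (N ⊔ (PushoutI.base φ).range).FiniteIndex) : N.FiniteIndex := by
  have h1 : (N.comap (PushoutI.base φ)).FiniteIndex := by
    have : N.comap (PushoutI.base φ) = (N.comap (PushoutI.of (φ := φ) i)).comap (φ i) := by
      rw [Subgroup.comap_comap, PushoutI.of_comp_eq_base]
    rw [this]
    refine ⟨?_⟩
    rw [Subgroup.index_comap]
    exact ne_zero_of_dvd_ne_zero h.index_ne_zero (Subgroup.relIndex_dvd_index_of_normal _ _)
  have h2 : N.relIndex (PushoutI.base φ).range ≠ 0 := by
    rw [← Subgroup.index_comap]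
    exact h1.index_ne_zero
  refine ⟨?_⟩
  rw [← Subgroup.relIndex_mul_index (le_sup_left : N ≤ N ⊔ (PushoutI.base φ).range), sup_comm,
    Subgroup.relIndex_sup_right, sup_comm]
  exact mul_ne_zero h2 hC.index_ne_zero

end Assembly

/-- Moon's theorem, amalgamated case.  Let `G = A ∗_C B` be an amalgamated
free product (possibly trivial), where the amalgamating group `C` (here `H`) is free abelian of
finite rank.  Suppose that neither factor contains a finitely generated nontrivial normal
subgroup of infinite index.  If `N` is a finitely generated normal subgroup of `G` not
contained in `C`, then either `G/N` is finite or `N` is a free group. -/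
theorem stmt_9 {H : Type*} [Group H] {K : Bool → Type*} [∀ i, Group (K i)]
    (φ : ∀ i, H →* K i) (hφ : ∀ i, Function.Injective (φ i))
    (hCfree : ∃ n : ℕ, Nonempty (H ≃* Multiplicative (Fin n → ℤ)))
    (hAB : ∀ i, ∀ L : Subgroup (K i), L.Normal → L.FG → L ≠ ⊥ → L.FiniteIndex)
    (N : Subgroup (PushoutI φ)) (hNnorm : N.Normal) (hNfg : N.FG)
    (hNC : ¬ N ≤ (PushoutI.base φ).range) :
    Finite (PushoutI φ ⧸ N) ∨ IsFreeGroup N := by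
  by_cases hsurj : ∃ i, Function.Surjective (φ i)
  · left
    obtain ⟨i, hi⟩ := hsurj
    have hs := PushoutI.of_not_surjective hi
    have hmap : (N.comap (PushoutI.of (φ := φ) (!i))).map (PushoutI.of (φ := φ) (!i)) = N :=
      Subgroup.map_comap_eq_self_of_surjective hs N
    have hL := hAB (!i) (N.comap (PushoutI.of (φ := φ) (!i))) inferInstance ?_ ?_
    · have : N.FiniteIndex := ⟨by
        rw [← Subgroup.index_comap_of_surjective N hs]
        exact hL.index_ne_zero⟩
      infer_instance
    · rw [Subgroup.fg_iff_submonoid_fg]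
      refine Submonoid.FG.map_injective (PushoutI.of (φ := φ) (!i))
        (PushoutI.of_injective hφ _) ?_
      change ((N.comap (PushoutI.of (φ := φ) (!i))).map (PushoutI.of (φ := φ) (!i))).toSubmonoid.FG
      rw [hmap, ← Subgroup.fg_iff_submonoid_fg]
      exact hNfg
    · intro hbot
      rw [hbot, Subgroup.map_bot] at hmap
      exact hNC (hmap ▸ bot_le)
  · have hns : ∀ i, ∃ x : K i, x ∉ (φ i).range := by
      intro i
      by_contra! h
      exact hsurj ⟨i, h⟩
    obtain ⟨n, ⟨f⟩⟩ := hCfree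
    rcases finiteIndex_or_bounded_pathChain N hNfg with hC | ⟨B, hB⟩
    · have := finite_orbitRel_treeEdge N hC
      have hfg := comap_of_fg hφ N hNfg (stabilizer_treeEdge_fg hφ f N)
      by_cases hbot : ∀ i, N.comap (PushoutI.of (φ := φ) i) = ⊥
      · exact .inr (isFreeGroup_of_comap_of_eq_bot hbot)
      · left
        obtain ⟨i, hi⟩ := not_forall.1 hbot
        have := finiteIndex_of_comap_of (hAB i _ inferInstance (hfg i) hi) hC
        infer_instance
    · exact absurd (le_range_of_bounded_pathChain hφ hns N hB) hNC
end

section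
/- Let G = A ∗_C B be an amalgamated free product (possibly trivial), and let φ : G →* ℤ be a group homomorphism such that the kernel of the restriction φ|_C is finitely generated and is not all of C. Then the kernel of φ is finitely generated if and only if the kernels of the restrictions φ|_A and φ|_B are both finitely generated. -/
open Monoid

/-- The free abelian group on a set `X` with an action of `N`, as a module over the integral group
ring of `N`. -/
def PermModule (N X : Type*) [Group N] [MulAction N X] : Type _ := X →₀ ℤ

namespace PermModule

open MonoidAlgebra (of)

variable {N X : Type*} [Group N] [MulAction N X]

noncomputable instance : AddCommGroup (PermModule N X) :=
  inferInstanceAs (AddCommGroup (X →₀ ℤ))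

variable (N X) in
/-- The action of `N` on `X →₀ ℤ` by permutation of the basis. -/
noncomputable def rep : N →* Module.End ℤ (X →₀ ℤ) where
  toFun n := Finsupp.lmapDomain ℤ ℤ (n • ·)
  map_one' := by ext; simp
  map_mul' m n := by ext; simp [mul_smul]

noncomputable instance : Module (MonoidAlgebra ℤ N) (PermModule N X) :=
  Module.compHom (X →₀ ℤ) (MonoidAlgebra.lift ℤ (Module.End ℤ (X →₀ ℤ)) N (rep N X)).toRingHom

variable (N) in
/-- The basis element of `PermModule N X` given by a point of `X`. -/
noncomputable def pt (x : X) : PermModule N X := Finsupp.single x (1 : ℤ)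

theorem of_smul_pt (n : N) (x : X) : of ℤ N n • pt N x = pt N (n • x) := by
  change MonoidAlgebra.lift ℤ (Module.End ℤ (X →₀ ℤ)) N (rep N X) (of ℤ N n)
    (Finsupp.single x 1) = Finsupp.single (n • x) 1
  simp [rep]

theorem pt_injective : Function.Injective (pt N : X → PermModule N X) :=
  Finsupp.single_left_injective one_ne_zero

theorem addHom_ext {M : Type*} [AddCommGroup M] {f g : PermModule N X →+ M}
    (h : ∀ x, f (pt N x) = g (pt N x)) : f = g := by
  refine Finsupp.addHom_ext' fun x => ?_
  ext
  exact h x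

/-- The additive map extending a map on points. -/
noncomputable def liftAdd {M : Type*} [AddCommGroup M] (f : X → M) : PermModule N X →+ M :=
  Finsupp.liftAddHom fun x => (zmultiplesHom M (f x))

@[simp]
theorem liftAdd_pt {M : Type*} [AddCommGroup M] (f : X → M) (x : X) :
    liftAdd f (pt N x) = f x :=
  (Finsupp.liftAddHom_apply_single (fun x => zmultiplesHom M (f x)) x (1 : ℤ)).trans (by simp)

theorem _root_.MonoidAlgebra.map_smul_of_map_of_smul {M M' : Type*} [AddCommGroup M]
    [AddCommGroup M'] [Module (MonoidAlgebra ℤ N) M] [Module (MonoidAlgebra ℤ N) M'] (f : M →+ M')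
    (h : ∀ (n : N) m, f (of ℤ N n • m) = of ℤ N n • f m) (r : MonoidAlgebra ℤ N) (m : M) :
    f (r • m) = r • f m := by
  induction r using MonoidAlgebra.induction_on with
  | of n => exact h n m
  | add a b ha hb => simp [add_smul, ha, hb]
  | smul z r hr => rw [smul_assoc, smul_assoc, map_zsmul, hr]

section lift

variable {M : Type*} [AddCommGroup M] [Module (MonoidAlgebra ℤ N) M]

/-- The linear map extending an equivariant map on points. -/
noncomputable def linearLift (f : X → M) (hf : ∀ (n : N) x, f (n • x) = of ℤ N n • f x) :
    PermModule N X →ₗ[MonoidAlgebra ℤ N] M where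
  toFun := liftAdd f
  map_add' := map_add _
  map_smul' := MonoidAlgebra.map_smul_of_map_of_smul _ fun n m => by
    have : (liftAdd f).comp (smulAddHom _ _ (of ℤ N n)) =
        (smulAddHom _ _ (of ℤ N n)).comp (liftAdd f) :=
      addHom_ext fun x => by
        simp only [AddMonoidHom.comp_apply, smulAddHom_apply]
        rw [of_smul_pt, liftAdd_pt, liftAdd_pt, hf]
    exact DFunLike.congr_fun this m

@[simp]
theorem linearLift_pt (f : X → M) (hf : ∀ (n : N) x, f (n • x) = of ℤ N n • f x) (x : X) :
    linearLift f hf (pt N x) = f x :=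
  liftAdd_pt f x

theorem hom_ext {f g : PermModule N X →ₗ[MonoidAlgebra ℤ N] M}
    (h : ∀ x, f (pt N x) = g (pt N x)) : f = g :=
  LinearMap.toAddMonoidHom_injective (addHom_ext h)

theorem span_pt_eq_top {S : Set X} (hS : ∀ x, ∃ n : N, ∃ s ∈ S, n • s = x) :
    Submodule.span (MonoidAlgebra ℤ N) (pt N '' S) = ⊤ := by
  rw [← Submodule.ker_mkQ (Submodule.span _ _), LinearMap.ker_eq_top]
  refine hom_ext fun x => ?_
  obtain ⟨n, s, hs, rfl⟩ := hS x
  have h0 : (Submodule.span (MonoidAlgebra ℤ N) (pt N '' S)).mkQ (pt N s) = 0 :=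
    (Submodule.Quotient.mk_eq_zero _).2 (Submodule.subset_span ⟨s, hs, rfl⟩)
  rw [← of_smul_pt, map_smul, LinearMap.zero_apply, h0, smul_zero]

end lift

/-- The presentation of `PermModule N X` by a free module on representatives of the orbits. -/
noncomputable def presentation {ι : Type*} (x : ι → X) :
    (ι →₀ MonoidAlgebra ℤ N) →ₗ[MonoidAlgebra ℤ N] PermModule N X :=
  Finsupp.linearCombination _ fun i => pt N (x i)

theorem presentation_surjective {ι : Type*} {x : ι → X}
    (hx : ∀ y, ∃ (i : ι) (n : N), n • x i = y) :
    Function.Surjective (presentation (N := N) x) := by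
  rw [← LinearMap.range_eq_top, presentation, Finsupp.range_linearCombination,
    Set.range_comp' (pt N) x]
  exact span_pt_eq_top fun y => by
    obtain ⟨i, n, h⟩ := hx y
    exact ⟨n, _, ⟨i, rfl⟩, h⟩

theorem ker_presentation_le {ι : Type*} {x : ι → X}
    (hx : ∀ y, ∃ (i : ι) (n : N), n • x i = y)
    (hx' : ∀ i j (n : N), n • x i = x j → i = j)
    (W : Submodule (MonoidAlgebra ℤ N) (ι →₀ MonoidAlgebra ℤ N))
    (hW : ∀ i, ∀ s ∈ MulAction.stabilizer N (x i),
      of ℤ N s • Finsupp.single i 1 - Finsupp.single i 1 ∈ W) :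
    LinearMap.ker (presentation (N := N) x) ≤ W := by
  choose i n hin using hx
  let g : X → (ι →₀ MonoidAlgebra ℤ N) ⧸ W := fun y =>
    of ℤ N (n y) • W.mkQ (Finsupp.single (i y) 1)
  have key (j : ι) (m : N) : g (m • x j) = of ℤ N m • W.mkQ (Finsupp.single j 1) := by
    have h := hin (m • x j)
    have hj : i (m • x j) = j := hx' _ _ (m⁻¹ * n (m • x j)) (by rw [mul_smul, h, inv_smul_smul])
    simp only [g, hj] at h ⊢
    have hs := hW j (m⁻¹ * n (m • x j)) (by
      rw [MulAction.mem_stabilizer_iff, mul_smul, h, inv_smul_smul])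
    rw [← W.ker_mkQ, LinearMap.mem_ker, map_sub, sub_eq_zero, map_smul] at hs
    nth_rw 2 [← hs]
    rw [← mul_smul, ← map_mul, mul_inv_cancel_left]
  have hg (m : N) (y : X) : g (m • y) = of ℤ N m • g y := by
    rw [← hin y, ← mul_smul, key, key, map_mul, mul_smul]
  have hcomp : linearLift g hg ∘ₗ presentation (N := N) x = W.mkQ := by
    refine Finsupp.lhom_ext' fun j => LinearMap.ext_ring ?_
    have h := key j 1
    rw [one_smul, map_one, one_smul] at h
    simp [presentation, h]
  rw [← W.ker_mkQ, ← hcomp]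
  exact LinearMap.ker_le_ker_comp _ _

theorem finitePresentation [Finite (MulAction.orbitRel.Quotient N X)]
    (h : ∀ x : X, (MulAction.stabilizer N x).FG) :
    Module.FinitePresentation (MonoidAlgebra ℤ N) (PermModule N X) := by
  let ι := MulAction.orbitRel.Quotient N X
  let x : ι → X := Quotient.out
  have hx (y : X) : ∃ (i : ι) (n : N), n • x i = y := by
    refine ⟨Quotient.mk _ y, ?_⟩
    exact (MulAction.orbitRel_apply (G := N)).1
      ((MulAction.orbitRel N X).symm (Quotient.mk_out (s := MulAction.orbitRel N X) y))
  have hx' (i j : ι) (n : N) (hn : n • x i = x j) : i = j := by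
    rw [← Quotient.out_eq i, ← Quotient.out_eq j]
    exact Quotient.sound
      ((MulAction.orbitRel N X).symm ((MulAction.orbitRel_apply (G := N)).2 ⟨n, hn⟩))
  choose T hT using fun i => h (x i)
  let e (i : ι) : ι →₀ MonoidAlgebra ℤ N := Finsupp.single i 1
  let W := Submodule.span (MonoidAlgebra ℤ N)
    (⋃ i, (fun s => of ℤ N s • e i - e i) '' (T i : Set N))
  have hker : LinearMap.ker (presentation (N := N) x) = W := by
    apply le_antisymm
    · refine ker_presentation_le hx hx' W fun i s hs => ?_
      change of ℤ N s • e i - e i ∈ W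
      rw [← hT i] at hs
      induction hs using Subgroup.closure_induction with
      | mem s hs => exact Submodule.subset_span (Set.mem_iUnion.2 ⟨i, s, hs, rfl⟩)
      | one => rw [map_one, one_smul, sub_self]; exact W.zero_mem
      | mul s t _ _ hs ht =>
        have := W.add_mem (W.smul_mem (of ℤ N s) ht) hs
        rwa [smul_sub, ← mul_smul, ← map_mul, sub_add_sub_cancel] at this
      | inv s _ hs =>
        have := W.neg_mem (W.smul_mem (of ℤ N s⁻¹) hs)
        rwa [smul_sub, ← mul_smul, ← map_mul, inv_mul_cancel, map_one, one_smul, neg_sub] at this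
    · rw [Submodule.span_le]
      rintro _ ⟨_, ⟨i, rfl⟩, s, hs, rfl⟩
      have hs' : s • x i = x i := by
        rw [← MulAction.mem_stabilizer_iff, ← hT i]
        exact Subgroup.subset_closure hs
      rw [SetLike.mem_coe, LinearMap.mem_ker, map_sub, map_smul]
      simp only [presentation, e, Finsupp.linearCombination_single, one_smul]
      rw [of_smul_pt, hs', sub_self]
  refine Module.finitePresentation_of_surjective (presentation (N := N) x)
    (presentation_surjective hx) ?_
  rw [hker]
  exact Submodule.fg_span (Set.finite_iUnion fun i => (T i).finite_toSet.image _)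

theorem fg_of_pretransitive [MulAction.IsPretransitive N X]
    [Module.FinitePresentation (MonoidAlgebra ℤ N) (PermModule N X)] (x : X) :
    (MulAction.stabilizer N x).FG := by
  have hx (y : X) : ∃ (_ : Unit) (n : N), n • x = y := ⟨(), MulAction.exists_smul_eq N x y⟩
  classical
  let f := presentation (N := N) fun _ : Unit => x
  let e : Unit →₀ MonoidAlgebra ℤ N := Finsupp.single () 1
  have hfg := Module.FinitePresentation.fg_ker f (presentation_surjective hx)
  have hker : LinearMap.ker f = Submodule.span (MonoidAlgebra ℤ N)
      ((fun s => of ℤ N s • e - e) '' (MulAction.stabilizer N x : Set N)) := by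
    apply le_antisymm
    · exact ker_presentation_le hx (fun _ _ _ _ => rfl) _ fun _ s hs =>
        Submodule.subset_span ⟨s, hs, rfl⟩
    · rw [Submodule.span_le]
      rintro _ ⟨s, hs, rfl⟩
      have hs' : s • x = x := hs
      rw [SetLike.mem_coe, LinearMap.mem_ker, map_sub, map_smul]
      simp only [f, presentation, e, Finsupp.linearCombination_single, one_smul]
      rw [of_smul_pt, hs', sub_self]
  rw [hker] at hfg
  obtain ⟨F, hF, hspan⟩ := (Submodule.fg_span_iff_fg_span_finset_subset _).1 hfg
  obtain ⟨T, hT, rfl⟩ := Finset.subset_set_image_iff.1 hF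
  refine ⟨T, le_antisymm ((Subgroup.closure_le _).2 hT) fun s hs => ?_⟩
  let D := Subgroup.closure (T : Set N)
  let g : (Unit →₀ MonoidAlgebra ℤ N) →ₗ[MonoidAlgebra ℤ N] PermModule N (N ⧸ D) :=
    Finsupp.linearCombination _ fun _ => pt N ((1 : N) : N ⧸ D)
  have hg (s : N) : g (of ℤ N s • e - e) = pt N (s : N ⧸ D) - pt N ((1 : N) : N ⧸ D) := by
    rw [map_sub, map_smul]
    simp only [g, e, Finsupp.linearCombination_single, one_smul]
    rw [of_smul_pt, MulAction.Quotient.smul_coe, smul_eq_mul, mul_one]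
  have hle : Submodule.span (MonoidAlgebra ℤ N)
      ((fun s => of ℤ N s • e - e) '' (MulAction.stabilizer N x : Set N)) ≤ LinearMap.ker g := by
    rw [hspan, Submodule.span_le, Finset.coe_image]
    rintro _ ⟨t, ht, rfl⟩
    rw [SetLike.mem_coe, LinearMap.mem_ker, hg, sub_eq_zero]
    exact congrArg _ (QuotientGroup.eq.2
      (by simpa using Subgroup.inv_mem _ (Subgroup.subset_closure ht)))
  have h0 : g (of ℤ N s • e - e) = 0 := hle (Submodule.subset_span ⟨s, hs, rfl⟩)
  rw [hg, sub_eq_zero] at h0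
  simpa using QuotientGroup.eq.1 (pt_injective h0).symm

theorem stabilizer_fg [Module.FinitePresentation (MonoidAlgebra ℤ N) (PermModule N X)] (x : X) :
    (MulAction.stabilizer N x).FG := by
  classical
  let O := MulAction.orbit N x
  let p : PermModule N X →ₗ[MonoidAlgebra ℤ N] PermModule N O :=
    linearLift (fun y => if h : y ∈ O then pt N (⟨y, h⟩ : O) else 0) fun n y => by
      by_cases h : y ∈ O
      · have h' : n • y ∈ O := MulAction.mem_orbit_of_mem_orbit n h
        rw [dif_pos h, dif_pos h', of_smul_pt]
        rfl
      · have h' : n • y ∉ O := fun h' => h (by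
          simpa using MulAction.mem_orbit_of_mem_orbit n⁻¹ h')
        rw [dif_neg h, dif_neg h', smul_zero]
  let i : PermModule N O →ₗ[MonoidAlgebra ℤ N] PermModule N X :=
    linearLift (fun y => pt N (y : X)) fun n y => (of_smul_pt n (y : X)).symm
  have hpi : p ∘ₗ i = .id := hom_ext fun y => by
    have hi : i (pt N y) = pt N (y : X) := linearLift_pt _ _ y
    have hp : p (pt N (y : X)) = if h : (y : X) ∈ O then pt N (⟨y, h⟩ : O) else 0 :=
      linearLift_pt _ _ (y : X)
    rw [LinearMap.comp_apply, hi, hp, dif_pos y.2]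
    rfl
  have hp : Function.Surjective p := fun z => ⟨i z, LinearMap.congr_fun hpi z⟩
  have : Module.FinitePresentation (MonoidAlgebra ℤ N) (PermModule N O) :=
    Module.finitePresentation_of_surjective p hp
      (LinearMap.ker_eq_range_of_comp_eq_id hpi ▸ .of_finite)
  have := fg_of_pretransitive (N := N) (⟨x, MulAction.mem_orbit_self x⟩ : O)
  convert this using 1
  ext n
  rw [MulAction.mem_stabilizer_iff, MulAction.mem_stabilizer_iff, Subtype.ext_iff]
  rfl

end PermModule

theorem Subgroup.fg_subgroupOf_iff {G : Type*} [Group G] {P N : Subgroup G} (h : P ≤ N) :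
    (P.subgroupOf N).FG ↔ P.FG := by
  rw [← Group.fg_iff_subgroup_fg, ← Group.fg_iff_subgroup_fg]
  exact ⟨fun _ => Group.fg_of_surjective (f := (Subgroup.subgroupOfEquivOfLe h).toMonoidHom)
      (Subgroup.subgroupOfEquivOfLe h).surjective,
    fun _ => Group.fg_of_surjective (f := (Subgroup.subgroupOfEquivOfLe h).symm.toMonoidHom)
      (Subgroup.subgroupOfEquivOfLe h).symm.surjective⟩

theorem Subgroup.FG.conj {G : Type*} [Group G] {P : Subgroup G} (h : P.FG) (g : G) :
    (P.map (MulAut.conj g).toMonoidHom).FG := by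
  rw [← Group.fg_iff_subgroup_fg] at h ⊢
  exact Group.fg_of_surjective (MonoidHom.subgroupMap_surjective (MulAut.conj g).toMonoidHom P)

namespace PermModule

variable {G : Type*} [Group G] {N : Subgroup G}

theorem stabilizer_mk [N.Normal] (A : Subgroup G) (g : G) :
    MulAction.stabilizer N (g : G ⧸ A) =
      ((N ⊓ A).map (MulAut.conj g).toMonoidHom).subgroupOf N := by
  ext n
  have h : (n : G) • (g : G ⧸ A) = (g : G ⧸ A) ↔ g⁻¹ * n * g ∈ A := by
    rw [MulAction.Quotient.smul_coe, smul_eq_mul, eq_comm, QuotientGroup.eq, mul_assoc]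
  rw [MulAction.mem_stabilizer_iff, Subgroup.mem_subgroupOf, Subgroup.mem_map]
  change (n : G) • (g : G ⧸ A) = (g : G ⧸ A) ↔ _
  rw [h]
  constructor
  · intro h
    refine ⟨g⁻¹ * n * g, ⟨?_, h⟩, by simp [mul_assoc]⟩
    simpa using ‹N.Normal›.conj_mem n n.2 g⁻¹
  · rintro ⟨a, ha, h⟩
    rw [← h]
    simpa [mul_assoc] using ha.2

theorem finitePresentation_quotient_iff [N.Normal] (A : Subgroup G)
    [Finite (MulAction.orbitRel.Quotient N (G ⧸ A))] :
    Module.FinitePresentation (MonoidAlgebra ℤ N) (PermModule N (G ⧸ A)) ↔ (N ⊓ A).FG := by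
  have hle (g : G) : (N ⊓ A).map (MulAut.conj g).toMonoidHom ≤ N := by
    rintro _ ⟨a, ha, rfl⟩
    exact ‹N.Normal›.conj_mem a ha.1 g
  constructor
  · intro
    have := stabilizer_fg (N := N) ((1 : G) : G ⧸ A)
    rw [stabilizer_mk, Subgroup.fg_subgroupOf_iff (hle 1)] at this
    convert this
    ext
    simp
  · intro h
    refine finitePresentation fun x => ?_
    obtain ⟨g, rfl⟩ := QuotientGroup.mk_surjective x
    rw [stabilizer_mk, Subgroup.fg_subgroupOf_iff (hle g)]
    exact h.conj g

variable (N) in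
/-- The map of permutation modules induced by an inclusion of subgroups. -/
noncomputable def ofLE {A B : Subgroup G} (h : A ≤ B) :
    PermModule N (G ⧸ A) →ₗ[MonoidAlgebra ℤ N] PermModule N (G ⧸ B) :=
  linearLift (fun x => pt N (Subgroup.quotientMapOfLE h x)) fun n x => by
    rw [of_smul_pt]
    obtain ⟨g, rfl⟩ := QuotientGroup.mk_surjective x
    rfl

@[simp]
theorem ofLE_pt {A B : Subgroup G} (h : A ≤ B) (g : G) :
    ofLE N h (pt N (g : G ⧸ A)) = pt N (g : G ⧸ B) :=
  linearLift_pt _ _ _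

section amalgam

variable {A B C : Subgroup G} (hCA : C ≤ A) (hCB : C ≤ B)

variable (N) in
/-- The boundary map of the chain complex of the Bass-Serre tree. -/
noncomputable def boundary : PermModule N (G ⧸ C) →ₗ[MonoidAlgebra ℤ N]
    PermModule N (G ⧸ A) × PermModule N (G ⧸ B) :=
  (ofLE N hCA).prod (-ofLE N hCB)

variable (N A B) in
/-- The augmentation map of the chain complex of the Bass-Serre tree. -/
noncomputable def augmentation : PermModule N (G ⧸ A) × PermModule N (G ⧸ B)
    →ₗ[MonoidAlgebra ℤ N] PermModule N (G ⧸ (⊤ : Subgroup G)) :=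
  (ofLE N le_top).coprod (ofLE N le_top)

theorem boundary_pt (g : G) :
    boundary N hCA hCB (pt N (g : G ⧸ C)) = (pt N (g : G ⧸ A), -pt N (g : G ⧸ B)) := by
  simp [boundary]

theorem augmentation_surjective : Function.Surjective (augmentation N A B) := by
  have h : augmentation N A B ∘ₗ LinearMap.inl _ _ _ = ofLE N le_top := by simp [augmentation]
  have h' : Function.Surjective (ofLE N (le_top : A ≤ ⊤)) := by
    rw [← LinearMap.range_eq_top, eq_top_iff, ← span_pt_eq_top (S := Set.univ) fun x =>
      ⟨1, x, trivial, one_smul _ _⟩, Submodule.span_le]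
    rintro _ ⟨x, -, rfl⟩
    obtain ⟨g, rfl⟩ := QuotientGroup.mk_surjective x
    exact ⟨_, ofLE_pt _ g⟩
  rw [← h] at h'
  exact Function.Surjective.of_comp h'

/-- `q g` behaves like the signed sum of the edges on the path in the Bass-Serre tree from the
vertex `B` to the vertex `g B`. -/
structure IsEdgePath (A B : Subgroup G) (q : G → PermModule N (G ⧸ C)) : Prop where
  one : q 1 = 0
  left : ∀ g, ∀ a ∈ A,
    q (g * a) + pt N ((g * a : G) : G ⧸ C) = q g + pt N (g : G ⧸ C)
  right : ∀ g, ∀ b ∈ B, q (g * b) = q g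

variable {q : G → PermModule N (G ⧸ C)}

/-- The contracting homotopy of the chain complex of the Bass-Serre tree given by edge paths. -/
noncomputable def contraction (hq : IsEdgePath A B q) :
    PermModule N (G ⧸ A) × PermModule N (G ⧸ B) →+ PermModule N (G ⧸ C) :=
  AddMonoidHom.coprod
    (liftAdd fun x =>
      Quotient.liftOn' x (fun g => q g + pt N (g : G ⧸ C)) fun g h hgh => by
        have := hq.left g _ (QuotientGroup.leftRel_apply.1 hgh)
        rwa [mul_inv_cancel_left, eq_comm] at this)
    (liftAdd fun x =>
      Quotient.liftOn' x q fun g h hgh => by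
        have := hq.right g _ (QuotientGroup.leftRel_apply.1 hgh)
        rwa [mul_inv_cancel_left, eq_comm] at this)

theorem contraction_left (hq : IsEdgePath A B q) (g : G) :
    contraction hq (pt N (g : G ⧸ A), 0) = q g + pt N (g : G ⧸ C) := by
  simp only [contraction, AddMonoidHom.coprod_apply, map_zero, add_zero]
  exact liftAdd_pt _ _

theorem contraction_right (hq : IsEdgePath A B q) (g : G) :
    contraction hq (0, pt N (g : G ⧸ B)) = q g := by
  simp only [contraction, AddMonoidHom.coprod_apply, map_zero, zero_add]
  exact liftAdd_pt _ _

theorem boundary_injective (hq : IsEdgePath A B q) :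
    Function.Injective (boundary N hCA hCB) := by
  have h : (contraction hq).comp (boundary N hCA hCB).toAddMonoidHom = AddMonoidHom.id _ := by
    refine addHom_ext fun x => ?_
    obtain ⟨g, rfl⟩ := QuotientGroup.mk_surjective x
    change contraction hq (boundary N hCA hCB (pt N (g : G ⧸ C))) = pt N (g : G ⧸ C)
    have h : (pt N (g : G ⧸ A), -pt N (g : G ⧸ B)) =
        (pt N (g : G ⧸ A), 0) - (0, pt N (g : G ⧸ B)) := by simp
    rw [boundary_pt, h, map_sub, contraction_left, contraction_right, add_sub_cancel_left]
  exact Function.LeftInverse.injective (g := contraction hq) (DFunLike.congr_fun h)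

theorem boundary_edgePath (hq : IsEdgePath A B q) (hAB : A ⊔ B = ⊤) (g : G) :
    boundary N hCA hCB (q g) = (0, pt N (g : G ⧸ B) - pt N ((1 : G) : G ⧸ B)) := by
  have hg : g ∈ Subgroup.closure ((A : Set G) ∪ B) := by
    rw [Subgroup.closure_union, Subgroup.closure_eq, Subgroup.closure_eq, hAB]
    trivial
  have step (g c : G) (hc : c ∈ (A : Set G) ∪ B)
      (ih : boundary N hCA hCB (q g) = (0, pt N (g : G ⧸ B) - pt N ((1 : G) : G ⧸ B))) :
      boundary N hCA hCB (q (g * c)) =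
        (0, pt N ((g * c : G) : G ⧸ B) - pt N ((1 : G) : G ⧸ B)) := by
    rcases hc with hc | hc
    · have h := congrArg (boundary N hCA hCB) (hq.left g c hc)
      have hA : ((g * c : G) : G ⧸ A) = g := by
        rw [eq_comm, QuotientGroup.eq]
        simpa using hc
      rw [map_add, map_add, boundary_pt, boundary_pt, ih, hA] at h
      rw [eq_sub_of_add_eq h]
      refine Prod.ext (by simp) ?_
      simp only [Prod.snd_sub, Prod.snd_add]
      abel
    · have hB : ((g * c : G) : G ⧸ B) = g := by
        rw [eq_comm, QuotientGroup.eq]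
        simpa using hc
      rw [hq.right g c hc, ih, hB]
  induction hg using Subgroup.closure_induction_right with
  | one => rw [hq.one, sub_self, map_zero]; rfl
  | mul_right g _ c hc ih => exact step g c hc ih
  | mul_inv_cancel g _ c hc ih =>
    exact step g c⁻¹ (hc.imp (A.inv_mem ·) (B.inv_mem ·)) ih

theorem exact_boundary_augmentation (hq : IsEdgePath A B q) (hAB : A ⊔ B = ⊤) :
    Function.Exact (boundary N hCA hCB) (augmentation N A B) := by
  rw [LinearMap.exact_iff]
  refine le_antisymm (fun z hz => ?_) (LinearMap.range_le_ker_iff.2 (hom_ext fun x => ?_))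
  · let t : PermModule N (G ⧸ (⊤ : Subgroup G)) →+ PermModule N (G ⧸ A) × PermModule N (G ⧸ B) :=
      liftAdd fun _ => (0, pt N ((1 : G) : G ⧸ B))
    have h : (boundary N hCA hCB).toAddMonoidHom.comp (contraction hq) +
        t.comp (augmentation N A B).toAddMonoidHom = AddMonoidHom.id _ := by
      refine (AddMonoidHom.coprod_unique _).symm.trans
        (Eq.trans ?_ (AddMonoidHom.coprod_unique _))
      congr 1
      · refine addHom_ext fun x => ?_
        obtain ⟨g, rfl⟩ := QuotientGroup.mk_surjective x
        change boundary N hCA hCB (contraction hq (pt N (g : G ⧸ A), 0)) +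
          t (augmentation N A B (pt N (g : G ⧸ A), 0)) = (pt N (g : G ⧸ A), 0)
        rw [contraction_left, map_add, boundary_pt, boundary_edgePath hCA hCB hq hAB]
        simp [augmentation, t]
        abel
      · refine addHom_ext fun x => ?_
        obtain ⟨g, rfl⟩ := QuotientGroup.mk_surjective x
        change boundary N hCA hCB (contraction hq (0, pt N (g : G ⧸ B))) +
          t (augmentation N A B (0, pt N (g : G ⧸ B))) = (0, pt N (g : G ⧸ B))
        rw [contraction_right, boundary_edgePath hCA hCB hq hAB]
        simp [augmentation, t]
    have hz' := DFunLike.congr_fun h z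
    refine ⟨contraction hq z, Eq.trans ?_ hz'⟩
    change _ = boundary N hCA hCB (contraction hq z) + t (augmentation N A B z)
    rw [LinearMap.mem_ker.1 hz, map_zero, add_zero]
  · obtain ⟨g, rfl⟩ := QuotientGroup.mk_surjective x
    rw [LinearMap.comp_apply, boundary_pt]
    simp [augmentation]

end amalgam
end PermModule

open PermModule in
theorem fg_inf_iff_of_isEdgePath {G : Type*} [Group G] {N : Subgroup G} [N.Normal]
    {A B C : Subgroup G} (hCA : C ≤ A) (hCB : C ≤ B) (hAB : A ⊔ B = ⊤)
    {q : G → PermModule N (G ⧸ C)} (hq : IsEdgePath A B q)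
    (hfin : ∀ D : Subgroup G, C ≤ D → Finite (MulAction.orbitRel.Quotient N (G ⧸ D)))
    (hC : (N ⊓ C).FG) : N.FG ↔ (N ⊓ A).FG ∧ (N ⊓ B).FG := by
  have := hfin A hCA
  have := hfin B hCB
  have := hfin C le_rfl
  have := hfin ⊤ le_top
  have hN := finitePresentation_quotient_iff (N := N) (⊤ : Subgroup G)
  rw [inf_top_eq] at hN
  rw [← hN, ← finitePresentation_quotient_iff, ← finitePresentation_quotient_iff]
  rw [← finitePresentation_quotient_iff] at hC
  have hker : LinearMap.ker (augmentation N A B) = LinearMap.range (boundary N hCA hCB) :=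
    LinearMap.exact_iff.1 (exact_boundary_augmentation hCA hCB hq hAB)
  have hker_fp : Module.FinitePresentation (MonoidAlgebra ℤ N)
      (LinearMap.ker (augmentation N A B)) := by
    rw [hker]
    exact .of_equiv (LinearEquiv.ofInjective _ (boundary_injective hCA hCB hq))
  constructor
  · intro
    have := Module.finitePresentation_of_ker (augmentation N A B) augmentation_surjective
    have : Module.Finite (MonoidAlgebra ℤ N) (PermModule N (G ⧸ A)) :=
      .of_surjective _ (LinearMap.fst_surjective (M₂ := PermModule N (G ⧸ B)))
    have : Module.Finite (MonoidAlgebra ℤ N) (PermModule N (G ⧸ B)) :=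
      .of_surjective _ (LinearMap.snd_surjective (M := PermModule N (G ⧸ A)))
    constructor
    · refine Module.finitePresentation_of_surjective
        (LinearMap.fst _ (PermModule N (G ⧸ A)) (PermModule N (G ⧸ B)))
        LinearMap.fst_surjective ?_
      rw [LinearMap.ker_fst]
      exact .of_finite
    · refine Module.finitePresentation_of_surjective
        (LinearMap.snd _ (PermModule N (G ⧸ A)) (PermModule N (G ⧸ B)))
        LinearMap.snd_surjective ?_
      rw [LinearMap.ker_snd]
      exact .of_finite
  · rintro ⟨_, _⟩
    exact Module.finitePresentation_of_surjective (augmentation N A B) augmentation_surjective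
      (Module.Finite.iff_fg.1 inferInstance)

theorem finite_orbits_ker_quotient {G : Type*} [Group G] (ψ : G →* Multiplicative ℤ)
    {c : G} (hc : ψ c ≠ 1) {D : Subgroup G} (hD : c ∈ D) :
    Finite (MulAction.orbitRel.Quotient ψ.ker (G ⧸ D)) := by
  let m := (Multiplicative.toAdd (ψ c)).natAbs
  have : NeZero m := ⟨fun h => hc (Int.natAbs_eq_zero.1 h)⟩
  let r : MulAction.orbitRel.Quotient ψ.ker (G ⧸ D) → G := fun o => o.out.out
  have hr o : Quotient.mk (MulAction.orbitRel ψ.ker (G ⧸ D)) (r o : G ⧸ D) = o := by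
    rw [QuotientGroup.out_eq', Quotient.out_eq]
  refine Finite.of_injective (fun o => ((Multiplicative.toAdd (ψ (r o)) : ℤ) : ZMod m))
    fun o o' h => ?_
  rw [← hr o, ← hr o']
  obtain ⟨k, hk⟩ := Int.natAbs_dvd.1 ((ZMod.intCast_eq_intCast_iff_dvd_sub _ _ m).1 h)
  refine Quotient.sound ((MulAction.orbitRel_apply (G := ψ.ker)).2
    ⟨⟨r o * c ^ k * (r o')⁻¹, ?_⟩, ?_⟩)
  · rw [MonoidHom.mem_ker, map_mul, map_mul, map_zpow, map_inv]
    apply Multiplicative.toAdd.injective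
    simp only [toAdd_mul, toAdd_zpow, toAdd_inv, toAdd_one, smul_eq_mul]
    linarith
  · change ((r o * c ^ k * (r o')⁻¹ * r o' : G) : G ⧸ D) = r o
    rw [inv_mul_cancel_right, eq_comm, QuotientGroup.eq, inv_mul_cancel_left]
    exact D.zpow_mem hD k

theorem Monoid.PushoutI.exists_isEdgePath {H : Type*} [Group H] {K : Bool → Type*}
    [∀ i, Group (K i)] (φ : ∀ i, H →* K i) (N : Subgroup (PushoutI φ)) :
    ∃ q : PushoutI φ → PermModule N (PushoutI φ ⧸ (PushoutI.base φ).range),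
      PermModule.IsEdgePath (PushoutI.of (φ := φ) true).range
        (PushoutI.of (φ := φ) false).range q := by
  let X := PushoutI φ ⧸ (PushoutI.base φ).range
  let ρ := PermModule.rep (PushoutI φ) X
  let e : Bool → (X →₀ ℤ) := fun i => bif i then Finsupp.single ((1 : PushoutI φ) : X) 1 else 0
  let f (i : Bool) : K i →* Function.End (X →₀ ℤ) :=
    { toFun := fun k m => ρ (PushoutI.of i k) (m - e i) + e i
      map_one' := by
        funext m
        simp [Function.End.one_def]
      map_mul' := fun k l => by
        funext m
        change ρ (PushoutI.of i (k * l)) (m - e i) + e i =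
          ρ (PushoutI.of i k) (ρ (PushoutI.of i l) (m - e i) + e i - e i) + e i
        rw [map_mul, map_mul, add_sub_cancel_right]
        rfl }
  have hρ (g : PushoutI φ) (g' : PushoutI φ) :
      ρ g (Finsupp.single (g' : X) 1) = Finsupp.single ((g * g' : PushoutI φ) : X) 1 := by
    simp only [ρ, PermModule.rep]
    exact Finsupp.mapDomain_single
  have he (i : Bool) (h : H) : ρ (PushoutI.base φ h) (e i) = e i := by
    cases i
    · simp [e]
    · have : ((PushoutI.base φ h * 1 : PushoutI φ) : X) = ((1 : PushoutI φ) : X) := by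
        rw [eq_comm, QuotientGroup.eq]
        exact ⟨h, by simp⟩
      exact (hρ _ _).trans (by rw [this]; rfl)
  let k : H →* Function.End (X →₀ ℤ) :=
    { toFun := fun h m => ρ (PushoutI.base φ h) m
      map_one' := by
        funext m
        simp [Function.End.one_def]
      map_mul' := fun x y => by
        rw [map_mul, map_mul]
        rfl }
  let F : PushoutI φ →* Function.End (X →₀ ℤ) := PushoutI.lift f k fun i => by
    refine MonoidHom.ext fun h => funext fun m => ?_
    change ρ (PushoutI.of i (φ i h)) (m - e i) + e i = ρ (PushoutI.base φ h) m
    rw [PushoutI.of_apply_eq_base, map_sub, he, sub_add_cancel]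
  have hF_of (i) (x : K i) (m : X →₀ ℤ) :
      F (PushoutI.of i x) m = ρ (PushoutI.of i x) (m - e i) + e i := by
    have h : F (PushoutI.of i x) = f i x := PushoutI.lift_of f k _ x
    exact congrFun h m
  have hF_base (h : H) (m : X →₀ ℤ) : F (PushoutI.base φ h) m = ρ (PushoutI.base φ h) m := by
    have h' : F (PushoutI.base φ h) = k h := PushoutI.lift_base f k _ h
    exact congrFun h' m
  have hF_mul (g g' : PushoutI φ) (m : X →₀ ℤ) : F (g * g') m = F g (F g' m) := by
    rw [map_mul]
    rfl
  have hF_add (g : PushoutI φ) : ∀ m m' : X →₀ ℤ, F g (m + m') = ρ g m + F g m' := by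
    induction g using PushoutI.induction_on with
    | of i k =>
      intro m m'
      rw [hF_of, hF_of, add_sub_assoc, map_add, add_assoc]
    | base h =>
      intro m m'
      rw [hF_base, hF_base, map_add]
    | mul x y hx hy =>
      intro m m'
      rw [hF_mul, hF_mul, hy, hx, map_mul]
      rfl
  have hq (g g' : PushoutI φ) : F (g * g') 0 = F g 0 + ρ g (F g' 0) := by
    rw [hF_mul, ← add_zero (F g' 0), hF_add, add_zero, add_comm]
  refine ⟨fun g => F g 0, ?_, ?_, ?_⟩
  · rw [map_one]
    rfl
  · rintro g _ ⟨a, rfl⟩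
    change F (g * PushoutI.of true a) 0 +
      Finsupp.single ((g * PushoutI.of true a : PushoutI φ) : X) 1 =
        F g 0 + Finsupp.single (g : X) 1
    have h1 : ρ (PushoutI.of true a) (e true) =
        Finsupp.single ((PushoutI.of (φ := φ) true a : PushoutI φ) : X) 1 := by
      simpa [e] using hρ (PushoutI.of true a) 1
    have h2 : ρ g (e true) = Finsupp.single (g : X) 1 := by
      simpa [e] using hρ g 1
    rw [hq, hF_of, zero_sub, map_neg, h1, map_add, map_neg, hρ, h2]
    abel
  · rintro g _ ⟨b, rfl⟩
    change F (g * PushoutI.of false b) 0 = F g 0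
    rw [hq, hF_of]
    simp [e]

theorem Monoid.PushoutI.range_of_sup_range_of {H : Type*} [Group H] {K : Bool → Type*}
    [∀ i, Group (K i)] (φ : ∀ i, H →* K i) :
    (PushoutI.of (φ := φ) true).range ⊔ (PushoutI.of (φ := φ) false).range = ⊤ := by
  have h (i : Bool) (k : K i) : PushoutI.of i k ∈
      (PushoutI.of (φ := φ) true).range ⊔ (PushoutI.of (φ := φ) false).range := by
    cases i
    · exact Subgroup.mem_sup_right ⟨k, rfl⟩
    · exact Subgroup.mem_sup_left ⟨k, rfl⟩
  rw [eq_top_iff]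
  intro g _
  induction g using PushoutI.induction_on with
  | of i k => exact h i k
  | base c => exact PushoutI.of_apply_eq_base φ true c ▸ h true _
  | mul x y hx hy => exact Subgroup.mul_mem _ (hx trivial) (hy trivial)

/-- Let `G = A ∗_C B` be an amalgamated free product (possibly trivial), and
let `ψ : G →* ℤ` be a homomorphism (to the infinite cyclic group, written multiplicatively)
such that the kernel of `ψ|_C`, i.e. `ker ψ ⊓ C`, is finitely generated and is not all of `C`.
Then `ker ψ` is finitely generated if and only if `ker ψ ⊓ A` and `ker ψ ⊓ B` are both
finitely generated. -/
theorem stmt_10 {H : Type*} [Group H] {K : Bool → Type*} [∀ i, Group (K i)]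
    (φ : ∀ i, H →* K i) (hφ : ∀ i, Function.Injective (φ i))
    (A B C : Subgroup (PushoutI φ))
    (hA : A = (PushoutI.of (φ := φ) true).range)
    (hB : B = (PushoutI.of (φ := φ) false).range)
    (hC : C = (PushoutI.base φ).range)
    (ψ : PushoutI φ →* Multiplicative ℤ)
    (hkerCfg : (ψ.ker ⊓ C).FG) (hkerC : ψ.ker ⊓ C ≠ C) :
    ψ.ker.FG ↔ (ψ.ker ⊓ A).FG ∧ (ψ.ker ⊓ B).FG := by
  subst hA hB hC
  have hle (i : Bool) : (PushoutI.base φ).range ≤ (PushoutI.of (φ := φ) i).range := by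
    rintro _ ⟨h, rfl⟩
    exact ⟨φ i h, PushoutI.of_apply_eq_base φ i h⟩
  obtain ⟨c, hc, hcψ⟩ := SetLike.not_le_iff_exists.1 fun h => hkerC (inf_eq_right.2 h)
  obtain ⟨q, hq⟩ := PushoutI.exists_isEdgePath φ ψ.ker
  exact fg_inf_iff_of_isEdgePath (hle true) (hle false) (PushoutI.range_of_sup_range_of φ) hq
    (fun D hD => finite_orbits_ker_quotient ψ hcψ (hD hc)) hkerCfg
end

section
/- Let G = A ∗_C B be an amalgamated free product and let N be a nontrivial normal subgroup of G with N ∩ C = {1}. Then N is a free group if and only if N ∩ A and N ∩ B are both free groups. -/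
open Monoid

universe u

section Cocycle

open MulAction

variable {A C G Q X : Type u} [Group A] [Group C] [Group G] [Group X]

/-- A function `c : G → Q → X` is a cocycle if `(q, x) ↦ (g • q, c g q * x)` is an action of `G`;
equivalently, it is a functor from the action groupoid of `G` on `Q` to `X`. -/
def IsCocycle [MulAction G Q] (c : G → Q → X) : Prop :=
  ∀ g h q, c (g * h) q = c g (h • q) * c h q

namespace IsCocycle

variable [MulAction G Q] {c : G → Q → X}

theorem map_one (hc : IsCocycle c) (q : Q) : c 1 q = 1 := by
  simpa using hc 1 1 q

theorem map_inv (hc : IsCocycle c) (g : G) (q : Q) : c g⁻¹ (g • q) = (c g q)⁻¹ := by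
  have h := hc g⁻¹ g q
  rw [inv_mul_cancel, hc.map_one] at h
  exact eq_inv_of_mul_eq_one_left h.symm

/-- The restriction of a cocycle to the stabilizer of a point is a homomorphism. -/
def stabilizerHom (hc : IsCocycle c) (q : Q) : stabilizer G q →* X where
  toFun g := c g q
  map_one' := hc.map_one q
  map_mul' g h := by
    have := hc (g : G) (h : G) q
    rwa [mem_stabilizer_iff.1 h.2] at this

/-- The action on `Q × X` defined by a cocycle. -/
def toPermHom (hc : IsCocycle c) : G →* Equiv.Perm (Q × X) :=
  letI : MulAction G (Q × X) :=
    { smul := fun g p => (g • p.1, c g p.1 * p.2)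
      one_smul := fun p => Prod.ext (one_smul G p.1) (by
        change c 1 p.1 * p.2 = p.2
        rw [hc.map_one, one_mul])
      mul_smul := fun g h p => Prod.ext (mul_smul g h p.1) (by
        change c (g * h) p.1 * p.2 = c g (h • p.1) * (c h p.1 * p.2)
        rw [hc, mul_assoc]) }
  MulAction.toPermHom G (Q × X)

theorem toPermHom_apply (hc : IsCocycle c) (g : G) (q : Q) (x : X) :
    hc.toPermHom g (q, x) = (g • q, c g q * x) :=
  rfl

/-- A cocycle is determined by its values on the stabilizers of orbit representatives and on
elements carrying each orbit representative to the points of its orbit. -/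
theorem apply_eq (hc : IsCocycle c) {σ : Q → Q} {τ : Q → G} (hσ : ∀ (g : G) q, σ (g • q) = σ q)
    (hτ : ∀ q, τ q • σ q = q) (g : G) (q : Q) :
    c g q = c (τ (g • q)) (σ q) * c ((τ (g • q))⁻¹ * g * τ q) (σ q) * (c (τ q) (σ q))⁻¹ := by
  have h₁ := hc (τ (g • q)) ((τ (g • q))⁻¹ * g * τ q) (σ q)
  have h₂ : ((τ (g • q))⁻¹ * g * τ q) • σ q = σ q := by
    rw [mul_smul, mul_smul, hτ, inv_smul_eq_iff]
    conv_lhs => rw [← hτ (g • q), hσ]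
  have h₃ := hc g (τ q) (σ q)
  rw [hτ] at h₃
  rw [h₂] at h₁
  rw [← h₁, eq_mul_inv_iff_mul_eq, ← h₃]
  group

theorem restrict {H : Type u} [Group H] [MulAction H Q] (hc : IsCocycle c) (i : H →* G)
    (hi : ∀ (h : H) (q : Q), i h • q = h • q) : IsCocycle fun h q => c (i h) q := by
  intro g h q
  simp only [_root_.map_mul, hc (i g), hi]

end IsCocycle

/-- Homomorphisms on the stabilizers of orbit representatives, together with values on elements
carrying each orbit representative to the points of its orbit, define a cocycle. -/
theorem exists_isCocycle [MulAction G Q] {σ : Q → Q} {τ : Q → G}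
    (hσ : ∀ (g : G) q, σ (g • q) = σ q) (hτ : ∀ q, τ q • σ q = q) (l : Q → X)
    (η : ∀ b : Q, stabilizer G b →* X) :
    ∃ c : G → Q → X, IsCocycle c ∧ ∀ g q (s : stabilizer G (σ q)),
      (τ (g • q))⁻¹ * g * τ q = s → c g q = l (g • q) * η (σ q) s * (l q)⁻¹ := by
  classical
  let η' (b : Q) (g : G) : X := if h : g ∈ stabilizer G b then η b ⟨g, h⟩ else 1
  have η'_mul (b : Q) (g h : G) (hg : g ∈ stabilizer G b) (hh : h ∈ stabilizer G b) :
      η' b (g * h) = η' b g * η' b h := by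
    simp only [η', hg, hh, mul_mem hg hh, dif_pos, ← map_mul]
    rfl
  have mem (g : G) (q : Q) : (τ (g • q))⁻¹ * g * τ q ∈ stabilizer G (σ q) := by
    rw [mem_stabilizer_iff, mul_smul, mul_smul, hτ, inv_smul_eq_iff]
    conv_lhs => rw [← hτ (g • q), hσ]
  refine ⟨fun g q => l (g • q) * η' (σ q) ((τ (g • q))⁻¹ * g * τ q) * (l q)⁻¹, ?_, ?_⟩
  · intro g h q
    have h₁ := mem g (h • q)
    rw [hσ] at h₁
    have h₂ : (τ ((g * h) • q))⁻¹ * (g * h) * τ q =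
        ((τ (g • h • q))⁻¹ * g * τ (h • q)) * ((τ (h • q))⁻¹ * h * τ q) := by
      rw [mul_smul]
      group
    have h₃ := η'_mul _ _ _ h₁ (mem h q)
    rw [← h₂] at h₃
    simp only [h₃, hσ]
    rw [mul_smul]
    group
  · intro g q s hs
    simp only [hs, η', s.2, dif_pos]

theorem exists_orbit_section (G Q : Type*) [Group G] [MulAction G Q] :
    ∃ r : Q → Q, (∀ (g : G) q, r (g • q) = r q) ∧ ∀ q, ∃ g : G, g • r q = q := by
  refine ⟨fun q => (Quotient.mk (orbitRel G Q) q).out, fun g q => ?_, fun q => ?_⟩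
  · exact congrArg Quotient.out (Quotient.sound (s := orbitRel G Q) (mem_orbit q g))
  · have h : orbitRel G Q _ q := Quotient.mk_out (s := orbitRel G Q) q
    obtain ⟨g, hg⟩ := (orbitRel G Q).symm h
    exact ⟨g, hg⟩

/-- If `C` acts freely on `Q` through a group `A` all of whose point stabilizers are free, then
the action groupoid of `A` is freely generated by the action groupoid of `C` and a family of
arrows. -/
theorem exists_relative_basis [MulAction A Q] [MulAction C Q] (i : C →* A)
    (hi : ∀ (d : C) (q : Q), i d • q = d • q) (hfree : ∀ (d : C) (q : Q), d • q = q → d = 1)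
    (hstab : ∀ q : Q, IsFreeGroup (stabilizer A q)) :
    ∃ (E : Type u) (src : E → Q) (arr : E → A), ∀ (X : Type u) [Group X] (c₀ : C → Q → X),
      IsCocycle c₀ → ∀ f : E → X, ∃! c : A → Q → X,
        IsCocycle c ∧ (∀ d q, c (i d) q = c₀ d q) ∧ ∀ e, c (arr e) (src e) = f e := by
  classical
  obtain ⟨ρ, hρ, hκ⟩ := exists_orbit_section C Q
  choose κ hκ using hκ
  obtain ⟨σ', hσ', ht⟩ := exists_orbit_section A Q
  choose t' ht' using ht
  let σ (q : Q) : Q := ρ (σ' q)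
  have hσ (a : A) (q : Q) : σ (a • q) = σ q := by simp only [σ, hσ']
  have ρ_ρ (q : Q) : ρ (ρ q) = ρ q := by
    conv_rhs => rw [← hκ q, hρ]
  have ρ_σ (q : Q) : ρ (σ q) = σ q := ρ_ρ _
  have ht (q : Q) : ∃ a : A, a • σ q = q ∧ (σ q = q → a = 1) := by
    by_cases h : σ q = q
    · exact ⟨1, by rw [one_smul, h], fun _ => rfl⟩
    · refine ⟨t' q * i (κ (σ' q)), ?_, fun h' => (h h').elim⟩
      rw [mul_smul, hi, hκ, ht']
  choose t ht t_one using ht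
  have σ_σ (q : Q) : σ (σ q) = σ q := by
    conv_rhs => rw [← ht q, hσ]
  have σ_ρ (q : Q) : σ (ρ q) = σ q := by
    conv_rhs => rw [← hκ q, ← hi, hσ]
  have κ_one (q : Q) (hq : ρ q = q) : κ q = 1 := 
    hfree _ q ((congrArg (κ q • ·) hq).symm.trans (hκ q))
  have κ_smul (d : C) (q : Q) : κ (d • q) = d * κ q := by
    rw [← inv_mul_eq_one]
    refine inv_eq_one.1 (hfree _ (ρ q) ?_)
    rw [mul_inv_rev, inv_inv, mul_smul, inv_smul_eq_iff, mul_smul, hκ]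
    conv_lhs => rw [← hρ d, hκ]
  let τ (q : Q) : A := i (κ q) * t (ρ q)
  have hτ (q : Q) : τ q • σ q = q := by
    simp only [τ, mul_smul]
    rw [← σ_ρ, ht, hi, hκ]
  have τ_one (q : Q) (hq : σ q = q) : τ q = 1 := by
    have h : ρ q = q := by rw [← hq, ρ_σ]
    simp only [τ, κ_one q h, h, t_one q hq, map_one, mul_one]
  refine ⟨{p // ρ p = p ∧ σ p ≠ p} ⊕ Σ b : {b // σ b = b},
      IsFreeGroup.Generators (stabilizer A (b : Q)),
    Sum.elim (fun p => σ p.1) (fun s => s.1), Sum.elim (fun p => t p.1)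
      (fun s => (IsFreeGroup.of s.2 : stabilizer A (s.1 : Q))), fun X _ c₀ hc₀ f => ?_⟩
  refine existsUnique_of_exists_of_unique ?_ ?_
  · let μ (p : Q) : X := if h : ρ p = p ∧ σ p ≠ p then f (Sum.inl ⟨p, h⟩) else 1
    let l (q : Q) : X := c₀ (κ q) (ρ q) * μ (ρ q)
    let η (b : Q) : stabilizer A b →* X :=
      if h : σ b = b then IsFreeGroup.lift (fun g => f (Sum.inr ⟨⟨b, h⟩, g⟩)) else 1
    have l_one (q : Q) (hq : σ q = q) : l q = 1 := by
      have h : ρ q = q := by rw [← hq, ρ_σ]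
      simp only [l, κ_one q h, h, hc₀.map_one, μ, hq]
      simp
    obtain ⟨c, hc, hcl⟩ := exists_isCocycle hσ hτ l η
    refine ⟨c, hc, fun d q => ?_, ?_⟩
    · rw [hcl _ _ 1 (by simp [τ, hi, hρ, κ_smul, mul_assoc]), map_one, mul_one, hi]
      simp only [l, hρ, κ_smul, hc₀ d, hκ]
      group
    · rintro (⟨p, hp⟩ | ⟨⟨b, hb⟩, g⟩)
      · simp only [Sum.elim_inl]
        rw [hcl _ _ 1 (by simp [ht, τ_one _ (σ_σ p)]; simp [τ, hp.1, κ_one p hp.1]), map_one,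
          mul_one, ht, l_one _ (σ_σ p)]
        simp only [l, hp.1, κ_one p hp.1, hc₀.map_one, one_mul, inv_one, mul_one]
        exact dif_pos hp
      · simp only [Sum.elim_inr]
        have hg : ((IsFreeGroup.of g : stabilizer A b) : A) • b = b :=
          (IsFreeGroup.of g : stabilizer A b).2
        have h := hcl (IsFreeGroup.of g : stabilizer A b) b ⟨(IsFreeGroup.of g : stabilizer A b),
          by rw [hb]; exact hg⟩ (by rw [hg]; simp [τ_one b hb])
        rw [h, hg, l_one b hb]
        have h' (b' : Q) (hb' : b' = b) (m) : η b' ⟨(IsFreeGroup.of g : stabilizer A b), m⟩ =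
            f (Sum.inr ⟨⟨b, hb⟩, g⟩) := by
          subst hb'
          simp only [η, dif_pos hb, Subtype.coe_eta, IsFreeGroup.lift_of]
        rw [h' _ hb]
        simp
  · rintro c c' ⟨hc, hcC, hcE⟩ ⟨hc', hcC', hcE'⟩
    have ht_eq (p : Q) (hp : ρ p = p) : c (t p) (σ p) = c' (t p) (σ p) := by
      by_cases h : σ p = p
      · rw [t_one p h, hc.map_one, hc'.map_one]
      · exact (hcE (Sum.inl ⟨p, hp, h⟩)).trans (hcE' (Sum.inl ⟨p, hp, h⟩)).symm
    have hτ_eq (q : Q) : c (τ q) (σ q) = c' (τ q) (σ q) := by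
      simp only [τ, hc _ (t _), hc' _ (t _), hcC, hcC']
      rw [← σ_ρ, ht_eq _ (ρ_ρ q)]
    have hs_eq (b : Q) (hb : σ b = b) : hc.stabilizerHom b = hc'.stabilizerHom b :=
      IsFreeGroup.ext_hom fun g =>
        (hcE (Sum.inr ⟨⟨b, hb⟩, g⟩)).trans (hcE' (Sum.inr ⟨⟨b, hb⟩, g⟩)).symm
    funext a q
    have h := hτ_eq (a • q)
    rw [hσ] at h
    rw [hc.apply_eq hσ hτ, hc'.apply_eq hσ hτ, hτ_eq, h]
    have mem : (τ (a • q))⁻¹ * a * τ q ∈ stabilizer A (σ q) := by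
      rw [mem_stabilizer_iff, mul_smul, mul_smul, hτ, inv_smul_eq_iff]
      conv_lhs => rw [← hτ (a • q), hσ]
    congr 2
    exact DFunLike.congr_fun (hs_eq _ (σ_σ q)) ⟨_, mem⟩

/-- A family of arrows of the action groupoid of `G` on `Q` that freely generates it. -/
def IsCocycleBasis (G : Type u) [Group G] [MulAction G Q] {E : Type u} (src : E → Q)
    (arr : E → G) : Prop :=
  ∀ (X : Type u) [Group X] (f : E → X),
    ∃! c : G → Q → X, IsCocycle c ∧ ∀ e, c (arr e) (src e) = f e

/-- The action groupoid of a free action is freely generated by some family of arrows. -/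
theorem exists_isCocycleBasis_of_free [MulAction C Q]
    (hfree : ∀ (d : C) (q : Q), d • q = q → d = 1) :
    ∃ (E : Type u) (src : E → Q) (arr : E → C), IsCocycleBasis C src arr := by
  obtain ⟨E, src, arr, h⟩ := exists_relative_basis (Q := Q) (⊥ : Subgroup C).subtype
    (fun _ _ => rfl) (fun d q _ => Subsingleton.elim _ _) (fun q => by
      have : Subsingleton (stabilizer C q) :=
        ⟨fun a b => Subtype.ext ((hfree _ q a.2).trans (hfree _ q b.2).symm)⟩
      let _ := uniqueOfSubsingleton (1 : stabilizer C q)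
      exact (FreeGroupBasis.ofRepr (ι := PEmpty.{u + 1})
        MulEquiv.ofUnique).isFreeGroup)
  refine ⟨E, src, arr, fun X _ f => ?_⟩
  have h₀ : IsCocycle (fun (_ : (⊥ : Subgroup C)) (_ : Q) => (1 : X)) := fun _ _ _ => by simp
  obtain ⟨c, ⟨hc, -, hcE⟩, huniq⟩ := h X _ h₀ f
  refine ⟨c, ⟨hc, hcE⟩, fun c' ⟨hc', hcE'⟩ => huniq c' ⟨hc', fun d q => ?_, hcE'⟩⟩
  rw [Subsingleton.elim d 1, _root_.map_one, hc'.map_one]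

/-- Cocycles on the two factors of an amalgamated product that agree on the amalgamated subgroup
extend uniquely to the whole group. -/
theorem existsUnique_isCocycle_of_amalgam [MulAction G Q] {A B C : Subgroup G} (hCA : C ≤ A)
    (hCB : C ≤ B) (hgen : Submonoid.closure (A ∪ B : Set G) = ⊤)
    (hext : ∀ (X : Type u) [Group X] (α : A →* X) (β : B →* X),
      (∀ x : C, α (Subgroup.inclusion hCA x) = β (Subgroup.inclusion hCB x)) →
      ∃ γ : G →* X, (∀ a : A, γ a = α a) ∧ ∀ b : B, γ b = β b)
    {cA : A → Q → X} {cB : B → Q → X} (hA : IsCocycle cA) (hB : IsCocycle cB)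
    (hAB : ∀ (x : C) q, cA (Subgroup.inclusion hCA x) q = cB (Subgroup.inclusion hCB x) q) :
    ∃! c : G → Q → X, IsCocycle c ∧ (∀ (a : A) q, c a q = cA a q) ∧ ∀ (b : B) q, c b q = cB b q := by
  refine existsUnique_of_exists_of_unique ?_ ?_
  · obtain ⟨γ, hγA, hγB⟩ := hext _ hA.toPermHom hB.toPermHom fun x => by
      ext ⟨q, y⟩ : 1
      simp only [IsCocycle.toPermHom_apply, hAB]
      rfl
    have key (g : G) (q : Q) (x : X) : γ g (q, x) = (g • q, (γ g (q, 1)).2 * x) := by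
      have hg : g ∈ Submonoid.closure (A ∪ B : Set G) := hgen ▸ Submonoid.mem_top g
      induction hg using Submonoid.closure_induction generalizing q x with
      | mem y hy =>
        rcases hy with hy | hy
        · simp [show γ y = _ from hγA ⟨y, hy⟩, IsCocycle.toPermHom_apply]
        · simp [show γ y = _ from hγB ⟨y, hy⟩, IsCocycle.toPermHom_apply]
      | one => simp
      | mul y z _ _ hy hz =>
        simp only [_root_.map_mul, Equiv.Perm.mul_apply]
        rw [hz q x, hy, hz q 1, hy _ ((γ z (q, 1)).2 * 1), mul_smul]
        simp [mul_assoc]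
    refine ⟨fun g q => (γ g (q, 1)).2, fun g h q => ?_, fun a q => ?_, fun b q => ?_⟩
    · simp only [_root_.map_mul, Equiv.Perm.mul_apply]
      rw [key h q 1, key g, mul_one]
    · simp [hγA, IsCocycle.toPermHom_apply]
    · simp [hγB, IsCocycle.toPermHom_apply]
  · rintro c c' ⟨hc, hcA, hcB⟩ ⟨hc', hcA', hcB'⟩
    funext g
    have hg : g ∈ Submonoid.closure (A ∪ B : Set G) := hgen ▸ Submonoid.mem_top g
    induction hg using Submonoid.closure_induction with
    | mem y hy =>
      funext q
      rcases hy with hy | hy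
      · exact (hcA ⟨y, hy⟩ q).trans (hcA' ⟨y, hy⟩ q).symm
      · exact (hcB ⟨y, hy⟩ q).trans (hcB' ⟨y, hy⟩ q).symm
    | one =>
      funext q
      rw [hc.map_one, hc'.map_one]
    | mul y z _ _ hy hz =>
      funext q
      rw [hc, hc', hy, hz]

/-- The action groupoid of an amalgamated product is freely generated by some family of arrows
when the amalgamated subgroup acts freely and the factors act with free point stabilizers. -/
theorem exists_isCocycleBasis_of_amalgam [MulAction G Q] {A B C : Subgroup G} (hCA : C ≤ A)
    (hCB : C ≤ B) (hgen : Submonoid.closure (A ∪ B : Set G) = ⊤)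
    (hext : ∀ (X : Type u) [Group X] (α : A →* X) (β : B →* X),
      (∀ x : C, α (Subgroup.inclusion hCA x) = β (Subgroup.inclusion hCB x)) →
      ∃ γ : G →* X, (∀ a : A, γ a = α a) ∧ ∀ b : B, γ b = β b)
    (hfree : ∀ (d : C) (q : Q), d • q = q → d = 1)
    (hstabA : ∀ q : Q, IsFreeGroup (stabilizer A q))
    (hstabB : ∀ q : Q, IsFreeGroup (stabilizer B q)) :
    ∃ (E : Type u) (src : E → Q) (arr : E → G), IsCocycleBasis G src arr := by
  obtain ⟨EC, srcC, arrC, hC⟩ := exists_isCocycleBasis_of_free hfree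
  obtain ⟨EA, srcA, arrA, hA⟩ := exists_relative_basis (Subgroup.inclusion hCA)
    (fun _ _ => rfl) hfree hstabA
  obtain ⟨EB, srcB, arrB, hB⟩ := exists_relative_basis (Subgroup.inclusion hCB)
    (fun _ _ => rfl) hfree hstabB
  refine ⟨EC ⊕ EA ⊕ EB, Sum.elim srcC (Sum.elim srcA srcB),
    Sum.elim (fun e => arrC e) (Sum.elim (fun e => arrA e) (fun e => arrB e)), fun X _ f => ?_⟩
  obtain ⟨cC, ⟨hcC, hcCE⟩, uC⟩ := hC X fun e => f (Sum.inl e)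
  obtain ⟨cA, ⟨hcA, hcAC, hcAE⟩, uA⟩ := hA X cC hcC fun e => f (Sum.inr (Sum.inl e))
  obtain ⟨cB, ⟨hcB, hcBC, hcBE⟩, uB⟩ := hB X cC hcC fun e => f (Sum.inr (Sum.inr e))
  obtain ⟨c, ⟨hc, hcA', hcB'⟩, u⟩ := existsUnique_isCocycle_of_amalgam hCA hCB hgen hext hcA hcB
    fun x q => (hcAC x q).trans (hcBC x q).symm
  refine ⟨c, ⟨hc, ?_⟩, fun c' ⟨hc', hE⟩ => ?_⟩
  · rintro (e | e | e)
    · exact (hcA' (Subgroup.inclusion hCA (arrC e)) _).trans ((hcAC _ _).trans (hcCE e))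
    · exact (hcA' _ _).trans (hcAE e)
    · exact (hcB' _ _).trans (hcBE e)
  · have eC := uC _ ⟨hc'.restrict C.subtype fun _ _ => rfl, fun e => hE (Sum.inl e)⟩
    have eA := uA _ ⟨hc'.restrict A.subtype fun _ _ => rfl, fun d q => congrFun₂ eC d q,
      fun e => hE (Sum.inr (Sum.inl e))⟩
    have eB := uB _ ⟨hc'.restrict B.subtype fun _ _ => rfl, fun d q => congrFun₂ eC d q,
      fun e => hE (Sum.inr (Sum.inr e))⟩
    exact u _ ⟨hc', congrFun₂ eA, congrFun₂ eB⟩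

open CategoryTheory in
/-- A subgroup `N` of `G` is free if the action groupoid of `G` on `G ⧸ N` is freely generated by
some family of arrows. -/
theorem IsCocycleBasis.isFreeGroup {N : Subgroup G} {E : Type u} {src : E → G ⧸ N} {arr : E → G}
    (hb : IsCocycleBasis G src arr) : IsFreeGroup N := by
  let _ : IsFreeGroupoid (ActionCategory G (G ⧸ N)) :=
    { quiverGenerators :=
        ⟨fun a b => {e : E // src e = ActionCategory.back a ∧
          arr e • src e = ActionCategory.back b}⟩
      of := fun {a b} e => ⟨arr e.1, (congrArg (arr e.1 • ·) e.2.1).symm.trans e.2.2⟩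
      unique_lift := by
        intro X _ f
        obtain ⟨c, ⟨hc, hcE⟩, u⟩ := hb X fun e =>
          @f ⟨(), src e⟩ ⟨(), arr e • src e⟩ ⟨e, rfl, rfl⟩
        let F : ActionCategory G (G ⧸ N) ⥤ SingleObj X :=
          { obj := fun _ => ()
            map := fun {a _} g => c g.val a.back
            map_id := fun a => hc.map_one a.back
            map_comp := fun {a b _} g h => by
              have hg : g.val • a.back = b.back := g.property
              refine (hc h.val g.val a.back).trans ?_
              rw [hg]
              rfl }
        refine ⟨F, ?_, fun F' hF' => ?_⟩
        · rintro ⟨⟨⟩, a⟩ ⟨⟨⟩, b⟩ ⟨e, he, he'⟩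
          obtain rfl : src e = a := he
          obtain rfl : arr e • src e = b := he'
          exact hcE e
        · let arrow (g : G) (q : G ⧸ N) :
              @Quiver.Hom (ActionCategory G (G ⧸ N)) _ ⟨(), q⟩ ⟨(), g • q⟩ := ⟨g, rfl⟩
          have hF : ∀ (a b : G ⧸ N) (g : G) (hg : g • a = b),
              F'.map (⟨g, hg⟩ : @Quiver.Hom (ActionCategory G (G ⧸ N)) _ ⟨(), a⟩ ⟨(), b⟩) =
                F'.map (arrow g a) := by
            rintro a _ g rfl
            rfl
          have key := u (fun g q => F'.map (arrow g q)) ⟨fun g h q => ?_, fun e => ?_⟩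
          · refine Functor.hext (fun _ => rfl) fun a b g => heq_of_eq ?_
            exact (hF a.back b.back g.val g.property).trans (congrFun₂ key g.val a.back)
          · have := F'.map_comp (arrow h q) (arrow g (h • q))
            exact (hF _ _ (g * h) (mul_smul g h q)).symm.trans this
          · exact hF' ⟨(), src e⟩ ⟨(), arr e • src e⟩ ⟨e, rfl, rfl⟩ }
  let r : ActionCategory G (G ⧸ N) := ⟨(), ((1 : G) : G ⧸ N)⟩
  let e := ActionCategory.endMulEquivSubgroup N
  let _ : Group (End r) := End.group r
  have hconn : IsConnected (ActionCategory G (G ⧸ N)) := inferInstance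
  have h : IsFreeGroup (End r) := @IsFreeGroupoid.endIsFreeOfConnectedFree _ _ hconn _ r
  exact IsFreeGroup.ofMulEquiv (G := End r) (MulEquiv.mk e.toEquiv fun x y => map_mul e x y)

theorem stabilizer_quotient_of_normal (N : Subgroup G) [N.Normal] (q : G ⧸ N) :
    stabilizer G q = N := by
  induction q using QuotientGroup.induction_on with
  | H x =>
    ext g
    rw [mem_stabilizer_iff, MulAction.Quotient.smul_coe, smul_eq_mul, eq_comm, QuotientGroup.eq,
      ← mul_assoc, ‹N.Normal›.mem_comm_iff]
    simp

/-- A normal subgroup of an amalgamated product that meets the amalgamated subgroup trivially and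
meets both factors in free groups is free. -/
theorem isFreeGroup_of_amalgam {A B C N : Subgroup G} [N.Normal] (hCA : C ≤ A)
    (hCB : C ≤ B) (hgen : Submonoid.closure (A ∪ B : Set G) = ⊤)
    (hext : ∀ (X : Type u) [Group X] (α : A →* X) (β : B →* X),
      (∀ x : C, α (Subgroup.inclusion hCA x) = β (Subgroup.inclusion hCB x)) →
      ∃ γ : G →* X, (∀ a : A, γ a = α a) ∧ ∀ b : B, γ b = β b)
    (hNC : N ⊓ C = ⊥) (hNA : IsFreeGroup ↥(N ⊓ A)) (hNB : IsFreeGroup ↥(N ⊓ B)) :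
    IsFreeGroup N := by
  have mem (q : G ⧸ N) (g : G) : g • q = q ↔ g ∈ N := by
    rw [← mem_stabilizer_iff, stabilizer_quotient_of_normal]
  have stab (D : Subgroup G) (hD : IsFreeGroup ↥(N ⊓ D)) (q : G ⧸ N) :
      IsFreeGroup (stabilizer D q) := by
    have e : stabilizer D q = N.subgroupOf D := by
      ext d
      exact mem q d
    rw [e, ← Subgroup.inf_subgroupOf_right]
    exact IsFreeGroup.ofMulEquiv (Subgroup.subgroupOfEquivOfLe inf_le_right).symm
  obtain ⟨E, src, arr, hb⟩ := exists_isCocycleBasis_of_amalgam (Q := G ⧸ N) hCA hCB hgen hext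
    (fun d q h => Subtype.ext (Subgroup.mem_bot.1 (hNC ▸ ⟨(mem q d).1 h, d.2⟩)))
    (stab A hNA) (stab B hNB)
  exact hb.isFreeGroup

end Cocycle

theorem IsFreeGroup.of_le {G : Type*} [Group G] {M N : Subgroup G} (h : M ≤ N)
    (hN : IsFreeGroup N) : IsFreeGroup M :=
  IsFreeGroup.ofMulEquiv (Subgroup.subgroupOfEquivOfLe h)

/-- Let `G = A ∗_C B` be an amalgamated free product and let `N` be a
nontrivial normal subgroup of `G` with `N ∩ C = {1}`.  Then `N` is a free group if and only
if `N ∩ A` and `N ∩ B` are both free groups. -/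
theorem stmt_11 {H : Type*} [Group H] {K : Bool → Type*} [∀ i, Group (K i)]
    (φ : ∀ i, H →* K i) (hφ : ∀ i, Function.Injective (φ i))
    (A B C N : Subgroup (PushoutI φ))
    (hA : A = (PushoutI.of (φ := φ) true).range)
    (hB : B = (PushoutI.of (φ := φ) false).range)
    (hC : C = (PushoutI.base φ).range)
    (hNnorm : N.Normal) (hNne : N ≠ ⊥) (hNC : N ⊓ C = ⊥) :
    IsFreeGroup N ↔ IsFreeGroup ↥(N ⊓ A) ∧ IsFreeGroup ↥(N ⊓ B) := by
  subst hA hB hC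
  refine ⟨fun h => ⟨h.of_le inf_le_left, h.of_le inf_le_left⟩, fun ⟨h₁, h₂⟩ => ?_⟩
  have hC (i : Bool) : (PushoutI.base φ).range ≤ (PushoutI.of (φ := φ) i).range := by
    rintro _ ⟨x, rfl⟩
    exact ⟨φ i x, PushoutI.of_apply_eq_base φ i x⟩
  refine isFreeGroup_of_amalgam (hC true) (hC false) ?_ (fun X _ α β hαβ => ?_) hNC h₁ h₂
  · rw [eq_top_iff]
    rintro g -
    induction g using PushoutI.induction_on with
    | of i g =>
      refine Submonoid.subset_closure ?_
      cases i
      · exact Or.inr ⟨g, rfl⟩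
      · exact Or.inl ⟨g, rfl⟩
    | base h => exact Submonoid.subset_closure (Or.inl (hC true ⟨h, rfl⟩))
    | mul x y hx hy => exact mul_mem hx hy
  · let f : ∀ i, K i →* X := fun i => match i with
      | true => α.comp (PushoutI.of (φ := φ) true).rangeRestrict
      | false => β.comp (PushoutI.of (φ := φ) false).rangeRestrict
    have hf : (f false).comp (φ false) = (f true).comp (φ true) := by
      ext x
      have h := hαβ ⟨PushoutI.base φ x, x, rfl⟩
      refine Eq.trans (congrArg β (Subtype.ext ?_)) (h.symm.trans (congrArg α (Subtype.ext ?_)))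
      · exact PushoutI.of_apply_eq_base φ false x
      · exact (PushoutI.of_apply_eq_base φ true x).symm
    refine ⟨PushoutI.lift f ((f true).comp (φ true)) (fun i => ?_), ?_, ?_⟩
    · cases i
      · exact hf
      · rfl
    · rintro ⟨_, a, rfl⟩
      exact PushoutI.lift_of f _ _ a
    · rintro ⟨_, b, rfl⟩
      exact PushoutI.lift_of f _ _ b
end

section
/- Let G = A∗_C be an HNN extension with base group A and associated subgroups C and D, and let N be a nontrivial normal subgroup of G with N ∩ C = {1}. Then N is a free group if and only if N ∩ A is a free group. -/
universe u

open MulAction CategoryTheory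

section Cocycle

/-- A cocycle of a group action: a functor from the action groupoid to a group `H`, written as
a function of a group element and the source of the corresponding arrow. -/
def IsActionCocycle {G Q H : Type*} [Group G] [MulAction G Q] [Group H] (α : G → Q → H) : Prop :=
  ∀ g h q, α (g * h) q = α g (h • q) * α h q

/-- An action has free cocycles if there is a family of arrows of its action groupoid
such that every labelling of the family by elements of a group extends uniquely to a cocycle. -/
def HasFreeCocycles (G Q : Type u) [Group G] [MulAction G Q] : Prop :=
  ∃ (ι : Type u) (e : ι → G) (x : ι → Q), ∀ (H : Type u) [Group H] (f : ι → H),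
    ∃! α : G → Q → H, IsActionCocycle α ∧ ∀ i, α (e i) (x i) = f i

namespace IsActionCocycle

variable {G Q H : Type*} [Group G] [MulAction G Q] [Group H] {α : G → Q → H}

protected theorem map_one (hα : IsActionCocycle α) (q : Q) : α 1 q = 1 := by
  have := hα 1 1 q
  simpa using this

protected theorem map_inv (hα : IsActionCocycle α) (g : G) (q : Q) :
    α g⁻¹ q = (α g (g⁻¹ • q))⁻¹ := by
  have := hα g g⁻¹ q
  rw [mul_inv_cancel, hα.map_one] at this
  exact eq_inv_of_mul_eq_one_right this.symm

/-- The functor from the action groupoid given by a cocycle. -/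
def toFunctor (hα : IsActionCocycle α) : ActionCategory G Q ⥤ SingleObj H where
  obj _ := ()
  map {a _} f := α f.val a.back
  map_id a := hα.map_one a.back
  map_comp {a b _} f g := by
    have h : f.val • a.back = b.back := f.property
    change α (g.val * f.val) a.back = α g.val b.back * α f.val a.back
    rw [hα, h]

theorem of_semidirectProduct (F : G →* (Q → H) ⋊[mulAutArrow] G) (hF : ∀ g, (F g).right = g) :
    IsActionCocycle fun (g : G) (q : Q) => (F g).left (g • q) := by
  intro g h q
  have : (F (g * h)).left ((g * h) • q) = (F g).left ((g * h) • q) *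
      (F h).left ((F g).right⁻¹ • (g * h) • q) := by
    rw [map_mul]
    rfl
  simpa [hF, mul_smul] using this

end IsActionCocycle

theorem CategoryTheory.ActionCategory.map_eq_map_homOfPair {G Q H : Type*} [Group G]
    [MulAction G Q] [Group H] (F : ActionCategory G Q ⥤ SingleObj H) {a b : ActionCategory G Q}
    (f : a ⟶ b) : (F.map f : H) = F.map (ActionCategory.homOfPair b.back f.val) := by
  induction f using ActionCategory.cases
  rfl

/-- The action groupoid of an action with free cocycles is free. -/
theorem HasFreeCocycles.nonempty_isFreeGroupoid {G Q : Type u} [Group G] [MulAction G Q]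
    (h : HasFreeCocycles G Q) : Nonempty (IsFreeGroupoid (ActionCategory G Q)) := by
  obtain ⟨ι, e, x, h⟩ := h
  refine ⟨{
    quiverGenerators :=
      ⟨fun (a b : ActionCategory G Q) => { i : ι // x i = a.back ∧ e i • x i = b.back }⟩
    of := fun {a b} i => Subtype.mk (e i.1) (by
      have h : e i.1 • a.back = b.back := (congrArg (e i.1 • ·) i.2.1).symm.trans i.2.2
      exact h)
    unique_lift := ?_ }⟩
  intro H _ f
  obtain ⟨α, ⟨hα, hαf⟩, huniq⟩ :=
    h H fun i => f (a := (⟨(), x i⟩ : ActionCategory G Q))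
      (b := (⟨(), e i • x i⟩ : ActionCategory G Q)) ⟨i, rfl, rfl⟩
  refine ⟨hα.toFunctor, ?_, ?_⟩
  · rintro ⟨⟨⟩, a : Q⟩ ⟨⟨⟩, b : Q⟩ ⟨i, hi : x i = a, hi' : e i • x i = b⟩
    subst hi hi'
    exact hαf i
  · intro E hE
    have hEα := huniq _ ⟨.of_semidirectProduct (ActionCategory.curry E) fun _ => rfl, fun i =>
      (ActionCategory.map_eq_map_homOfPair E _).symm.trans (hE (⟨(), x i⟩ : ActionCategory G Q)
        (⟨(), e i • x i⟩ : ActionCategory G Q) ⟨i, rfl, rfl⟩)⟩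
    apply Functor.hext
    · intro
      rfl
    · intro a b g
      have hg : g.val • a.back = b.back := g.property
      refine heq_of_eq ((ActionCategory.map_eq_map_homOfPair E g).trans ?_)
      rw [← hg]
      exact congrFun (congrFun hEα g.val) a.back

/-- A subgroup whose coset action has free cocycles is free. -/
theorem HasFreeCocycles.isFreeGroup {G : Type u} [Group G] {N : Subgroup G}
    (h : HasFreeCocycles G (G ⧸ N)) : IsFreeGroup N := by
  obtain ⟨inst⟩ := h.nonempty_isFreeGroupoid
  have hconn : IsConnected (ActionCategory G (G ⧸ N)) := inferInstance
  exact @IsFreeGroup.ofMulEquiv _ _ (@IsFreeGroupoid.endIsFreeOfConnectedFree _ _ hconn inst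
    (ActionCategory.objEquiv G (G ⧸ N) ↑(1 : G))) _ _ (ActionCategory.endMulEquivSubgroup N)

open Classical in
/-- An action with free stabilizers has free cocycles. -/
theorem hasFreeCocycles_of_isFreeGroup_stabilizer {G Q : Type u} [Group G] [MulAction G Q]
    (hfree : ∀ q : Q, IsFreeGroup (stabilizer G q)) : HasFreeCocycles G Q := by
  let r : Q → Q := fun q => (Quotient.mk (orbitRel G Q) q).out
  have r_smul (g : G) (q : Q) : r (g • q) = r q :=
    congrArg Quotient.out (Quotient.sound (s := orbitRel G Q) ⟨g, rfl⟩)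
  have exists_smul (q : Q) : ∃ g : G, g • r q = q := by
    obtain ⟨g, hg⟩ := Quotient.mk_out (s := orbitRel G Q) q
    refine ⟨g⁻¹, ?_⟩
    rw [inv_smul_eq_iff]
    exact hg.symm
  obtain ⟨s, hs, hs_one⟩ : ∃ s : Q → G, (∀ q, s q • r q = q) ∧ ∀ q, r q = q → s q = 1 := by
    choose s hs using exists_smul
    refine ⟨fun q => if r q = q then 1 else s q, fun q => ?_, fun q hq => if_pos hq⟩
    dsimp only
    split_ifs with hq
    · simpa using hq
    · exact hs q
  have r_r (q : Q) : r (r q) = r q := by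
    conv_rhs => rw [← hs q, r_smul]
  have mem (g : G) (q : Q) : (s (g • q))⁻¹ * g * s q ∈ stabilizer G (r q) := by
    rw [mem_stabilizer_iff, mul_smul, mul_smul, hs, inv_smul_eq_iff, ← r_smul g q, hs]
  refine ⟨{q // r q ≠ q} ⊕ Σ q : {q // r q = q}, IsFreeGroup.Generators (stabilizer G q.1),
    Sum.elim (fun q => s q) (fun i => (IsFreeGroup.of i.2 : stabilizer G i.1.1)),
    Sum.elim (fun q => r q) (fun i => i.1), ?_⟩
  intro H _ f
  let w : Q → H := fun q => if hq : r q ≠ q then f (.inl ⟨q, hq⟩) else 1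
  have w_rep (q : Q) (hq : r q = q) : w q = 1 := by simp [w, hq]
  have w_of (q : {q // r q ≠ q}) : w q = f (.inl q) := dif_pos q.2
  let ψ (q : {q // r q = q}) : stabilizer G q.1 →* H :=
    IsFreeGroup.lift fun i => f (.inr ⟨q, i⟩)
  let α : G → Q → H := fun g q =>
    w (g • q) * ψ ⟨r q, r_r q⟩ ⟨(s (g • q))⁻¹ * g * s q, mem g q⟩ * (w q)⁻¹
  have ψ_congr (q q' : Q) (hq hq') (h : q = q') (g g' : G) (hg hg') (h' : g = g') :
      ψ ⟨q, hq⟩ ⟨g, hg⟩ = ψ ⟨q', hq'⟩ ⟨g', hg'⟩ := by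
    subst h h'
    rfl
  refine ⟨α, ⟨?_, ?_⟩, ?_⟩
  · intro g h q
    have e1 : ψ ⟨r q, r_r q⟩ ⟨(s ((g * h) • q))⁻¹ * (g * h) * s q, mem _ q⟩ =
        ψ ⟨r (h • q), r_r _⟩ ⟨(s (g • h • q))⁻¹ * g * s (h • q), mem _ _⟩ *
          ψ ⟨r q, r_r q⟩ ⟨(s (h • q))⁻¹ * h * s q, mem h q⟩ := by
      rw [ψ_congr (r (h • q)) (r q) (r_r _) (r_r q) (r_smul h q)
        ((s (g • h • q))⁻¹ * g * s (h • q)) _ (mem _ _)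
        (by simpa only [r_smul] using mem g (h • q)) rfl, ← map_mul]
      apply ψ_congr _ _ _ _ rfl
      simp only [mul_smul]
      group
    simp only [α]
    rw [e1, mul_smul]
    group
  · rintro (⟨q, hq⟩ | ⟨⟨q, hq⟩, i⟩)
    · have e1 : ψ ⟨r (r q), r_r _⟩ ⟨(s (s q • r q))⁻¹ * s q * s (r q), mem _ _⟩ = 1 := by
        rw [ψ_congr _ _ _ (r_r _) rfl _ 1 _ (one_mem _)]
        · exact map_one (ψ ⟨r (r q), r_r _⟩)
        · rw [hs, hs_one (r q) (r_r q)]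
          group
      simp only [Sum.elim_inl, α, e1]
      rw [hs, w_rep (r q) (r_r q), ← w_of ⟨q, hq⟩]
      simp
    · have hk : (IsFreeGroup.of i : stabilizer G q).1 • q = q := (IsFreeGroup.of i).2
      have e1 : ψ ⟨r q, r_r _⟩ ⟨(s ((IsFreeGroup.of i : stabilizer G q).1 • q))⁻¹ *
          (IsFreeGroup.of i : stabilizer G q).1 * s q, mem _ _⟩ = f (.inr ⟨⟨q, hq⟩, i⟩) := by
        rw [ψ_congr _ q _ hq hq _ (IsFreeGroup.of i : stabilizer G q).1 _ (IsFreeGroup.of i).2]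
        · exact IsFreeGroup.lift_of _ i
        · rw [hk, hs_one q hq]
          group
      simp only [Sum.elim_inr, α, e1]
      rw [hk, w_rep q hq]
      simp
  · rintro β ⟨hβ, hβf⟩
    have β_s (q : Q) : β (s q) (r q) = w q := by
      by_cases hq : r q = q
      · rw [w_rep q hq, hs_one q hq, hβ.map_one]
      · exact (hβf (.inl ⟨q, hq⟩)).trans (w_of ⟨q, hq⟩).symm
    have β_stab (q : {q // r q = q}) (k : stabilizer G q.1) : β k q = ψ q k := by
      let β' : stabilizer G q.1 →* H :=
        MonoidHom.mk' (fun k => β k q) fun k k' => by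
          have hk' : (k' : G) • q.1 = q.1 := k'.2
          rw [Subgroup.coe_mul, hβ, hk']
      have : β' = ψ q := IsFreeGroup.ext_hom fun i => by
        rw [IsFreeGroup.lift_of]
        exact hβf (.inr ⟨q, i⟩)
      exact DFunLike.congr_fun this k
    funext g q
    have e1 : β g q * w q =
        w (g • q) * ψ ⟨r q, r_r q⟩ ⟨(s (g • q))⁻¹ * g * s q, mem g q⟩ := by
      have hm : ((s (g • q))⁻¹ * g * s q) • r q = r q := mem g q
      have e2 : g * s q = s (g • q) * ((s (g • q))⁻¹ * g * s q) := by group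
      have e3 := hβ g (s q) (r q)
      rw [hs, e2, hβ, hm, β_s] at e3
      rw [← e3, ← β_s (g • q), r_smul, ← β_stab]
    exact eq_mul_inv_of_mul_eq e1

end Cocycle

section HNN

open HNNExtension

variable {A : Type u} [Group A] {C D : Subgroup A} {φ : C ≃* D} {Q H : Type*}
  [MulAction (HNNExtension A C D φ) Q] [Group H]

/-- Two cocycles of an HNN extension are equal if they agree on the base group and on the
stable letter. -/
theorem IsActionCocycle.hnn_ext {α β : HNNExtension A C D φ → Q → H}
    (hα : IsActionCocycle α) (hβ : IsActionCocycle β) (hof : ∀ a q, α (of a) q = β (of a) q)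
    (ht : ∀ q, α t q = β t q) : α = β := by
  funext g
  induction g using HNNExtension.induction_on with
  | of a => exact funext (hof a)
  | t => exact funext ht
  | mul x y hx hy => funext q; rw [hα, hβ, hx, hy]
  | inv x hx => funext q; rw [hα.map_inv, hβ.map_inv, hx]

variable [MulAction A Q]

/-- A cocycle of the base group and compatible values on the stable letter define a cocycle of
the HNN extension. -/
theorem IsActionCocycle.exists_hnn_lift
    (hact : ∀ (a : A) (q : Q), (of a : HNNExtension A C D φ) • q = a • q)
    {α : A → Q → H} (hα : IsActionCocycle α) (τ : Q → H)
    (hτ : ∀ (c : C) (q : Q), τ ((c : A) • q) * α c q =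
      α (φ c) ((t : HNNExtension A C D φ) • q) * τ q) :
    ∃ β : HNNExtension A C D φ → Q → H, IsActionCocycle β ∧
      (∀ a q, β (of a) q = α a q) ∧ ∀ q, β t q = τ q := by
  let f : A →* (Q → H) ⋊[mulAutArrow] HNNExtension A C D φ :=
    MonoidHom.mk' (fun a => ⟨fun q => α a (a⁻¹ • q), of a⟩) fun a b => by
      ext q
      · change α (a * b) ((a * b)⁻¹ • q) = α a (a⁻¹ • q) *
          α b (b⁻¹ • (of a : HNNExtension A C D φ)⁻¹ • q)
        rw [hα, ← map_inv, hact, mul_inv_rev, mul_smul, smul_inv_smul]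
      · exact map_mul of a b
  have hf (a : A) : f a = ⟨fun q => α a (a⁻¹ • q), of a⟩ := rfl
  let F : HNNExtension A C D φ →* (Q → H) ⋊[mulAutArrow] HNNExtension A C D φ :=
    lift f ⟨fun q => τ ((t : HNNExtension A C D φ)⁻¹ • q), t⟩ fun c => by
      ext q
      · change τ ((t : HNNExtension A C D φ)⁻¹ • q) *
          α c ((c : A)⁻¹ • (t : HNNExtension A C D φ)⁻¹ • q) =
          α (φ c) ((φ c : A)⁻¹ • q) *
            τ ((t : HNNExtension A C D φ)⁻¹ • (of (φ c : A) : HNNExtension A C D φ)⁻¹ • q)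
        have h := hτ c ((c : A)⁻¹ • (t : HNNExtension A C D φ)⁻¹ • q)
        have e1 : (t : HNNExtension A C D φ) • (c : A)⁻¹ • (t : HNNExtension A C D φ)⁻¹ • q =
            (φ c : A)⁻¹ • q := by
          rw [← hact, ← hact, map_inv, map_inv, equiv_eq_conj]
          simp [mul_smul]
        have e2 : (t : HNNExtension A C D φ)⁻¹ • (of (φ c : A) : HNNExtension A C D φ)⁻¹ • q =
            (c : A)⁻¹ • (t : HNNExtension A C D φ)⁻¹ • q := by
          rw [inv_smul_eq_iff, e1, ← map_inv, hact]
        rw [smul_inv_smul, e1] at h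
        rw [e2, h]
      · exact t_mul_of c
  have F_right (g : HNNExtension A C D φ) : (F g).right = g := by
    have : SemidirectProduct.rightHom.comp F = MonoidHom.id _ := by
      ext a
      · simp [F, hf]
      · simp [F]
    exact DFunLike.congr_fun this g
  refine ⟨fun g q => (F g).left (g • q), .of_semidirectProduct F F_right, fun a q => ?_,
    fun q => ?_⟩
  · simp [F, hf, hact]
  · simp [F]

/-- If the associated subgroup `C` acts freely, a cocycle of the base group and arbitrary labels
on a transversal of the orbits of `C` determine compatible values on the stable letter. -/
theorem IsActionCocycle.existsUnique_stable
    (hact : ∀ (a : A) (q : Q), (of a : HNNExtension A C D φ) • q = a • q)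
    (hC : ∀ (c : C) (q : Q), c • q = q → c = 1)
    {α : A → Q → H} (hα : IsActionCocycle α) (v : orbitRel.Quotient C Q → H) :
    ∃! τ : Q → H, (∀ (c : C) (q : Q), τ ((c : A) • q) * α c q =
      α (φ c) ((t : HNNExtension A C D φ) • q) * τ q) ∧
      ∀ o : orbitRel.Quotient C Q, τ (Quotient.out o) = v o := by
  let o : Q → orbitRel.Quotient C Q := fun q => Quotient.mk (orbitRel C Q) q
  let r : Q → Q := fun q => (o q).out
  have o_smul (c : C) (q : Q) : o (c • q) = o q := Quotient.sound (s := orbitRel C Q) ⟨c, rfl⟩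
  have exists_smul (q : Q) : ∃ c : C, c • r q = q := by
    obtain ⟨c, hc⟩ := Quotient.mk_out (s := orbitRel C Q) q
    refine ⟨c⁻¹, ?_⟩
    rw [inv_smul_eq_iff]
    exact hc.symm
  choose s hs using exists_smul
  have s_unique (c : C) (q : Q) (hc : c • r q = q) : c = s q := by
    have := hC ((s q)⁻¹ * c) (r q) (by rw [mul_smul, hc, inv_smul_eq_iff, hs])
    exact (inv_mul_eq_one.mp this).symm
  have s_smul (c : C) (q : Q) : s (c • q) = c * s q :=
    (s_unique _ _ (by simp only [r, o_smul]; rw [mul_smul]; exact congrArg _ (hs q))).symm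
  have t_smul (c : C) (q : Q) : (φ c : A) • (t : HNNExtension A C D φ) • q =
      (t : HNNExtension A C D φ) • (c : A) • q := by
    rw [← hact, ← hact, ← mul_smul, ← mul_smul, t_mul_of]
  refine ⟨fun q => α (φ (s q)) ((t : HNNExtension A C D φ) • r q) * v (o q) *
    (α (s q) (r q))⁻¹, ⟨fun c q => ?_, fun p => ?_⟩, ?_⟩
  · have hsq : ((s q : C) : A) • r q = q := hs q
    have e1 : α (s (c • q)) (r q) = α c q * α (s q) (r q) := by
      rw [s_smul, Subgroup.coe_mul, hα, hsq]
    have e2 : α (φ (s (c • q))) ((t : HNNExtension A C D φ) • r q) =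
        α (φ c) ((t : HNNExtension A C D φ) • q) *
          α (φ (s q)) ((t : HNNExtension A C D φ) • r q) := by
      rw [s_smul, map_mul, Subgroup.coe_mul, hα, t_smul, hsq]
    have e3 : r (c • q) = r q := congrArg Quotient.out (o_smul c q)
    change α (φ (s (c • q))) ((t : HNNExtension A C D φ) • r (c • q)) * v (o (c • q)) *
      (α (s (c • q)) (r (c • q)))⁻¹ * α c q = _
    rw [e3, e1, e2, o_smul]
    group
  · have hp : o p.out = p := Quotient.out_eq p
    have e1 : s p.out = 1 := (s_unique 1 _ (by simp only [r, hp, one_smul])).symm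
    simp [hp, e1, hα.map_one]
  · rintro τ ⟨hτ, hτv⟩
    funext q
    have h := hτ (s q) (r q)
    have hsq : ((s q : C) : A) • r q = q := hs q
    rw [hsq, hτv] at h
    exact eq_mul_inv_of_mul_eq h

/-- If the base group of an HNN extension has free cocycles and the associated subgroup acts
freely, then the HNN extension has free cocycles. -/
theorem HasFreeCocycles.hnnExtension {A Q : Type u} [Group A] {C D : Subgroup A} {φ : C ≃* D}
    [MulAction (HNNExtension A C D φ) Q] [MulAction A Q]
    (hact : ∀ (a : A) (q : Q), (of a : HNNExtension A C D φ) • q = a • q)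
    (hC : ∀ (c : C) (q : Q), c • q = q → c = 1) (hA : HasFreeCocycles A Q) :
    HasFreeCocycles (HNNExtension A C D φ) Q := by
  obtain ⟨ι, e, x, hA⟩ := hA
  refine ⟨ι ⊕ orbitRel.Quotient C Q, Sum.elim (fun i => of (e i)) fun _ => t,
    Sum.elim x Quotient.out, fun H _ f => ?_⟩
  obtain ⟨α, ⟨hα, hαf⟩, α_unique⟩ := hA H fun i => f (.inl i)
  obtain ⟨τ, ⟨hτ, hτf⟩, τ_unique⟩ := hα.existsUnique_stable hact hC fun o => f (.inr o)
  obtain ⟨β, hβ, β_of, β_t⟩ := hα.exists_hnn_lift hact τ hτ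
  refine ⟨β, ⟨hβ, ?_⟩, ?_⟩
  · rintro (i | o)
    · exact (β_of _ _).trans (hαf i)
    · exact (β_t _).trans (hτf o)
  · rintro γ ⟨hγ, hγf⟩
    have γ_of : (fun a q => γ (of a) q) = α :=
      α_unique _ ⟨fun a b q => by simp only [map_mul, hγ _ _ q, hact], fun i => hγf (.inl i)⟩
    have γ_of' (a : A) (q : Q) : γ (of a) q = α a q := congrFun (congrFun γ_of a) q
    have γ_t : (fun q => γ t q) = τ := by
      refine τ_unique _ ⟨fun c q => ?_, fun o => hγf (.inr o)⟩
      have h := congrArg (γ · q) (t_mul_of (φ := φ) c)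
      simpa only [hγ _ _ q, hact, γ_of'] using h
    refine hγ.hnn_ext hβ (fun a q => ?_) fun q => ?_
    · rw [γ_of', β_of]
    · rw [β_t, ← γ_t]

end HNN

theorem Subgroup.Normal.smul_quotient_eq_iff {G : Type*} [Group G] {N : Subgroup G}
    (hN : N.Normal) (g : G) (q : G ⧸ N) : g • q = q ↔ g ∈ N := by
  induction q using QuotientGroup.induction_on with
  | H x =>
    rw [MulAction.Quotient.smul_coe, eq_comm, QuotientGroup.eq, smul_eq_mul, ← mul_assoc]
    simpa using (hN.mem_comm_iff (a := x⁻¹ * g) (b := x))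

/-- Let `G = A∗_C` be an HNN extension with base group `A` and associated
subgroups `C` and `D`, and let `N` be a nontrivial normal subgroup of `G` with `N ∩ C = {1}`.
Then `N` is a free group if and only if `N ∩ A` is a free group. -/
theorem stmt_12 {A : Type*} [Group A] (C D : Subgroup A) (φ : C ≃* D)
    (N : Subgroup (HNNExtension A C D φ)) (hNnorm : N.Normal) (hNne : N ≠ ⊥)
    (hNC : N ⊓ Subgroup.map (HNNExtension.of : A →* HNNExtension A C D φ) C = ⊥) :
    IsFreeGroup N ↔ IsFreeGroup ↥(N ⊓ (HNNExtension.of : A →* HNNExtension A C D φ).range) := by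
  refine ⟨fun _ => IsFreeGroup.ofMulEquiv (Subgroup.subgroupOfEquivOfLe inf_le_left),
    fun hfree => ?_⟩
  let _ : MulAction A (HNNExtension A C D φ ⧸ N) :=
    MulAction.compHom _ (HNNExtension.of : A →* HNNExtension A C D φ)
  have hact (a : A) (q : HNNExtension A C D φ ⧸ N) :
      (HNNExtension.of a : HNNExtension A C D φ) • q = a • q := rfl
  refine HasFreeCocycles.isFreeGroup (HasFreeCocycles.hnnExtension (φ := φ) hact (fun c q hc => ?_)
    (hasFreeCocycles_of_isFreeGroup_stabilizer fun q => ?_))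
  · have hcN : (HNNExtension.of (c : A) : HNNExtension A C D φ) ∈ N :=
      (hNnorm.smul_quotient_eq_iff (HNNExtension.of (c : A)) q).mp hc
    have : (HNNExtension.of (c : A) : HNNExtension A C D φ) ∈ (⊥ : Subgroup _) :=
      hNC ▸ ⟨hcN, Subgroup.mem_map_of_mem _ c.2⟩
    rw [Subgroup.mem_bot, ← map_one HNNExtension.of] at this
    exact Subtype.ext (HNNExtension.of_injective φ this)
  · have hstab : stabilizer A q = N.comap HNNExtension.of := by
      ext a
      exact hNnorm.smul_quotient_eq_iff _ q
    have hmap : (stabilizer A q).map (HNNExtension.of : A →* HNNExtension A C D φ) =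
        N ⊓ HNNExtension.of.range := by
      rw [hstab, Subgroup.map_comap_eq, inf_comm]
    rw [← hmap] at hfree
    exact IsFreeGroup.ofMulEquiv
      ((stabilizer A q).equivMapOfInjective _ (HNNExtension.of_injective φ)).symm
end
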